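/- For every ε > 0 there exists a constant C = C(ε) such that for all natural numbers N ≥ 2, the number of integer tuples (n_1, …, n_{10}) with 1 ≤ n_i ≤ N for all i, satisfying Σ_{1 ≤ i ≤ 5} (n_i^3 − n_{5+i}^3) = 0, |Σ_{1 ≤ i ≤ 5} (n_i^2 − n_{5+i}^2)| ≤ N, and Σ_{1 ≤ i ≤ 5} (n_i − n_{5+i}) = 0, is at most C N^{5+ε}. -/

import Mathlib

namespace CubicSystem

open Finset
open scoped ComplexConjugate

section

/-- The finite group in which the power sums are compared. -/
abbrev Grp (B : ℕ) := ZMod (B + 1) × ZMod (B + 1) × ZMod (B + 1)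

/-- The dual group of `Grp B`. -/
abbrev Dual (B : ℕ) := AddChar (Grp B) ℂ

/-- Reduction of integer vectors modulo `B + 1`. -/
def red (B : ℕ) : ℤ × ℤ × ℤ →+ Grp B :=
  (Int.castAddHom (ZMod (B + 1))).prodMap
    ((Int.castAddHom (ZMod (B + 1))).prodMap (Int.castAddHom (ZMod (B + 1))))

/-- Evaluation of a character at an integer vector. -/
noncomputable def ev {B : ℕ} (ψ : Dual B) (z : ℤ × ℤ × ℤ) : ℂ := ψ (red B z)

/-- All coordinates are at most `B` in absolute value. -/
def InBox (B : ℕ) (z : ℤ × ℤ × ℤ) : Prop := |z.1| ≤ B ∧ |z.2.1| ≤ B ∧ |z.2.2| ≤ B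

/-- The normalised sum over the dual group. -/
noncomputable def mean {B : ℕ} (f : Dual B → ℝ) : ℝ := (∑ ψ, f ψ) / Fintype.card (Dual B)

variable {B : ℕ}

lemma ev_add (ψ : Dual B) (x y : ℤ × ℤ × ℤ) : ev ψ (x + y) = ev ψ x * ev ψ y := by
  simp [ev, AddChar.map_add_eq_mul]

lemma ev_zero (ψ : Dual B) : ev ψ 0 = 1 := by
  simp [ev]

lemma norm_ev (ψ : Dual B) (x : ℤ × ℤ × ℤ) : ‖ev ψ x‖ = 1 := by
  simp [ev]

lemma conj_ev (ψ : Dual B) (x : ℤ × ℤ × ℤ) : conj (ev ψ x) = ev ψ (-x) := by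
  simp [ev, AddChar.map_neg_eq_conj]

lemma ev_sum {ι : Type*} (ψ : Dual B) (s : Finset ι) (v : ι → ℤ × ℤ × ℤ) :
    ev ψ (∑ i ∈ s, v i) = ∏ i ∈ s, ev ψ (v i) := by
  classical
  induction s using Finset.induction_on with
  | empty => simp [ev_zero]
  | insert a s ha ih => rw [Finset.sum_insert ha, Finset.prod_insert ha, ev_add, ih]

lemma red_eq_zero {z : ℤ × ℤ × ℤ} (hz : InBox B z) : red B z = 0 ↔ z = 0 := by
  constructor
  · intro h
    obtain ⟨a, b, c⟩ := z
    obtain ⟨ha, hb, hc⟩ := hz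
    simp only [red, AddMonoidHom.prodMap, Prod.ext_iff] at h
    simp only [AddMonoidHom.prod_apply, AddMonoidHom.coe_comp, AddMonoidHom.coe_fst,
      AddMonoidHom.coe_snd, Function.comp_apply, Int.coe_castAddHom, Prod.fst_zero,
      Prod.snd_zero, ZMod.intCast_zmod_eq_zero_iff_dvd] at h
    have key : ∀ x : ℤ, |x| ≤ B → ((B + 1 : ℕ) : ℤ) ∣ x → x = 0 := by
      intro x hx hd
      apply Int.eq_zero_of_abs_lt_dvd hd
      push_cast
      linarith
    rw [key a ha h.1, key b hb h.2.1, key c hc h.2.2]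
    rfl
  · rintro rfl
    simp

lemma card_dual_pos : (0 : ℝ) < Fintype.card (Dual B) := by
  exact_mod_cast Fintype.card_pos

lemma sum_ev (z : ℤ × ℤ × ℤ) :
    ∑ ψ : Dual B, ev ψ z = if red B z = 0 then (Fintype.card (Dual B) : ℂ) else 0 := by
  have := AddChar.sum_apply_eq_ite (α := Grp B) (red B z)
  rw [AddChar.card_eq]
  exact this

lemma mean_mono {f g : Dual B → ℝ} (h : ∀ ψ, f ψ ≤ g ψ) : mean f ≤ mean g := by
  unfold mean
  gcongr with ψ
  exact h ψ

lemma mean_nonneg {f : Dual B → ℝ} (h : ∀ ψ, 0 ≤ f ψ) : 0 ≤ mean f := by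
  unfold mean
  have := sum_nonneg fun ψ (_ : ψ ∈ univ) => h ψ
  positivity

lemma mean_const_mul (c : ℝ) (f : Dual B → ℝ) : mean (fun ψ => c * f ψ) = c * mean f := by
  unfold mean
  rw [← mul_sum, mul_div_assoc]

lemma mean_add (f g : Dual B → ℝ) : mean (fun ψ => f ψ + g ψ) = mean f + mean g := by
  unfold mean
  rw [sum_add_distrib, add_div]

lemma mean_sum {ι : Type*} (s : Finset ι) (f : ι → Dual B → ℝ) :
    mean (fun ψ => ∑ i ∈ s, f i ψ) = ∑ i ∈ s, mean (f i) := by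
  unfold mean
  rw [sum_comm, sum_div]

/-- The exponential sum attached to a finite family of integer vectors. -/
noncomputable def expSum {τ : Type*} (T : Finset τ) (v : τ → ℤ × ℤ × ℤ) (ψ : Dual B) : ℂ :=
  ∑ t ∈ T, ev ψ (v t)

/-- The number of coincidences between two finite families of integer vectors. -/
def coinc {τ σ : Type*} (T : Finset τ) (v : τ → ℤ × ℤ × ℤ) (S : Finset σ)
    (w : σ → ℤ × ℤ × ℤ) : ℕ :=
  #{p ∈ T ×ˢ S | v p.1 = w p.2}

section

variable {τ σ : Type*} (T : Finset τ) (v : τ → ℤ × ℤ × ℤ) (S : Finset σ) (w : σ → ℤ × ℤ × ℤ)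

lemma sum_expSum_mul_conj :
    ∑ ψ : Dual B, expSum T v ψ * conj (expSum S w ψ)
      = (#{p ∈ T ×ˢ S | red B (v p.1 - w p.2) = 0} : ℂ) * Fintype.card (Dual B) := by
  have h : ∀ ψ : Dual B, expSum T v ψ * conj (expSum S w ψ)
      = ∑ p ∈ T ×ˢ S, ev ψ (v p.1 - w p.2) := by
    intro ψ
    unfold expSum
    rw [map_sum, sum_mul_sum, sum_product]
    refine sum_congr rfl fun i _ => sum_congr rfl fun j _ => ?_
    rw [conj_ev, sub_eq_add_neg, ev_add]
  simp_rw [h]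
  rw [sum_comm]
  simp_rw [sum_ev]
  rw [← sum_filter, sum_const, nsmul_eq_mul]

lemma coinc_le_mean :
    (coinc T v S w : ℝ) ≤ mean (B := B) fun ψ => ‖expSum T v ψ‖ * ‖expSum S w ψ‖ := by
  have h := sum_expSum_mul_conj (B := B) T v S w
  have h1 : (coinc T v S w : ℝ) ≤ #{p ∈ T ×ˢ S | red B (v p.1 - w p.2) = 0} := by
    unfold coinc
    gcongr with p
    intro hp
    rw [hp, sub_self, map_zero]
  refine h1.trans ?_
  unfold mean
  rw [le_div_iff₀ card_dual_pos]
  have h2 := congrArg norm h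
  rw [norm_mul, Complex.norm_natCast, Complex.norm_natCast] at h2
  rw [← h2]
  refine (norm_sum_le _ _).trans (sum_le_sum fun ψ _ => ?_)
  rw [norm_mul, RCLike.norm_conj]

lemma mean_norm_sq (h : ∀ t ∈ T, ∀ s ∈ T, InBox B (v t - v s)) :
    mean (B := B) (fun ψ => ‖expSum T v ψ‖ ^ 2) = coinc T v T v := by
  have h0 := sum_expSum_mul_conj (B := B) T v T v
  have h1 : #{p ∈ T ×ˢ T | red B (v p.1 - v p.2) = 0} = coinc T v T v := by
    unfold coinc
    congr 1
    refine filter_congr fun p hp => ?_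
    rw [mem_product] at hp
    rw [red_eq_zero (h _ hp.1 _ hp.2), sub_eq_zero]
  rw [h1] at h0
  unfold mean
  rw [div_eq_iff card_dual_pos.ne']
  have h2 : ∀ ψ : Dual B, expSum T v ψ * conj (expSum T v ψ) = ((‖expSum T v ψ‖ ^ 2 : ℝ) : ℂ) := by
    intro ψ
    rw [Complex.mul_conj, Complex.normSq_eq_norm_sq]
  simp_rw [h2] at h0
  exact_mod_cast h0

lemma expSum_product :
    (fun ψ : Dual B => expSum (T ×ˢ S) (fun p => v p.1 + w p.2) ψ)
      = fun ψ => expSum T v ψ * expSum S w ψ := by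
  funext ψ
  unfold expSum
  rw [sum_mul_sum, sum_product]
  simp_rw [ev_add]

end

/-- The point on the moment curve. -/
def mom (n : ℤ) : ℤ × ℤ × ℤ := (n, n ^ 2, n ^ 3)

/-- The vector of power sums of a tuple. -/
def ps {k : ℕ} (t : Fin k → ℤ) : ℤ × ℤ × ℤ := ∑ i, mom (t i)

lemma ps_eq {k : ℕ} (t : Fin k → ℤ) : ps t = (∑ i, t i, ∑ i, t i ^ 2, ∑ i, t i ^ 3) := by
  simp [ps, mom, Prod.ext_iff, Prod.fst_sum, Prod.snd_sum]

/-- The `k`-tuples with entries in `S`. -/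
def tup (k : ℕ) (S : Finset ℤ) : Finset (Fin k → ℤ) := Fintype.piFinset fun _ => S

lemma mem_tup {k : ℕ} {S : Finset ℤ} {t : Fin k → ℤ} : t ∈ tup k S ↔ ∀ i, t i ∈ S := by
  simp [tup]

lemma expSum_tup (k : ℕ) (S : Finset ℤ) (ψ : Dual B) :
    expSum (tup k S) ps ψ = expSum S mom ψ ^ k := by
  unfold expSum ps tup
  simp_rw [ev_sum]
  have h := Finset.prod_univ_sum (fun _ : Fin k => S) (fun _ n => ev ψ (mom n))
  rw [← h]
  simp

lemma norm_expSum_le {τ : Type*} (T : Finset τ) (v : τ → ℤ × ℤ × ℤ) (ψ : Dual B) :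
    ‖expSum T v ψ‖ ≤ #T := by
  unfold expSum
  refine (norm_sum_le _ _).trans ?_
  simp [norm_ev]

/-- Hölder's inequality for `mean` with exponents `1 / θ` and `1 / (1 - θ)`. -/
lemma mean_rpow_mul_rpow_le {θ : ℝ} (h0 : 0 < θ) (h1 : θ < 1) {f g : Dual B → ℝ}
    (hf : ∀ ψ, 0 ≤ f ψ) (hg : ∀ ψ, 0 ≤ g ψ) :
    mean (fun ψ => f ψ ^ θ * g ψ ^ (1 - θ)) ≤ mean f ^ θ * mean g ^ (1 - θ) := by
  have hc : (θ⁻¹).HolderConjugate (1 - θ)⁻¹ := by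
    rw [Real.holderConjugate_iff]
    refine ⟨(one_lt_inv₀ h0).2 h1, ?_⟩
    simp
  have h1' : (1 - θ) ≠ 0 := by linarith
  have := Real.inner_le_Lp_mul_Lq_of_nonneg univ hc (f := fun ψ => f ψ ^ θ)
    (g := fun ψ => g ψ ^ (1 - θ)) (fun ψ _ => Real.rpow_nonneg (hf ψ) _)
    (fun ψ _ => Real.rpow_nonneg (hg ψ) _)
  simp only [one_div, inv_inv, Real.rpow_rpow_inv (hf _) h0.ne', Real.rpow_rpow_inv (hg _) h1']
    at this
  unfold mean
  have hC := card_dual_pos (B := B)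
  rw [Real.div_rpow (sum_nonneg fun ψ _ => hf ψ) hC.le,
    Real.div_rpow (sum_nonneg fun ψ _ => hg ψ) hC.le, div_mul_div_comm, ← Real.rpow_add hC]
  simp only [add_sub_cancel, Real.rpow_one]
  gcongr

end

/-- The divisor bound. -/
lemma exists_card_divisors_le {ε : ℝ} (hε : 0 < ε) :
    ∃ C : ℝ, 1 ≤ C ∧ ∀ n : ℕ, 1 ≤ n → (#n.divisors : ℝ) ≤ C * (n : ℝ) ^ ε := by
  obtain ⟨P, hP⟩ := exists_nat_gt ((2 : ℝ) ^ (1 / ε))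
  set x : ℝ := ε * Real.log 2 with hx
  have hx0 : 0 < x := mul_pos hε (Real.log_pos (by norm_num))
  set c : ℝ := 1 + 1 / x with hc
  have hc1 : 1 ≤ c := by
    have : 0 < 1 / x := by positivity
    linarith
  refine ⟨c ^ P, one_le_pow₀ hc1, fun n hn => ?_⟩
  have hn0 : n ≠ 0 := by omega
  have key : ∀ p ∈ n.primeFactors, ((n.factorization p + 1 : ℕ) : ℝ)
      ≤ (if p < P then c else 1) * ((p : ℝ) ^ n.factorization p) ^ ε := by
    intro p hp
    have hp2 : 2 ≤ p := (Nat.prime_of_mem_primeFactors hp).two_le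
    have hp2' : (2 : ℝ) ≤ p := by exact_mod_cast hp2
    set e := n.factorization p
    have hcomm : ((p : ℝ) ^ e) ^ ε = ((p : ℝ) ^ ε) ^ e := by
      rw [← Real.rpow_natCast, ← Real.rpow_mul (by positivity), mul_comm,
        Real.rpow_mul (by positivity), Real.rpow_natCast]
    split_ifs with h
    · have h1 : ((2 : ℝ) ^ e) ^ ε ≤ ((p : ℝ) ^ e) ^ ε := by gcongr
      have h2 : ((2 : ℝ) ^ e) ^ ε = Real.exp (x * e) := by
        rw [← Real.rpow_natCast, ← Real.rpow_mul (by norm_num),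
          Real.rpow_def_of_pos (by norm_num), hx]
        ring_nf
      have h3 := Real.add_one_le_exp (x * e)
      have h4 : ((e + 1 : ℕ) : ℝ) ≤ c * (x * e + 1) := by
        have : c * (x * e + 1) = x * e + 1 / x + e + 1 := by
          rw [hc]
          field_simp
          ring
        rw [this]
        push_cast
        have : 0 ≤ x * e + 1 / x := by positivity
        linarith
      calc ((e + 1 : ℕ) : ℝ) ≤ c * (x * e + 1) := h4
        _ ≤ c * ((p : ℝ) ^ e) ^ ε := by
          gcongr
          linarith
    · rw [one_mul, hcomm]
      have h1 : (2 : ℝ) ≤ (p : ℝ) ^ ε := by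
        have h3 : (2 : ℝ) ^ (1 / ε) ≤ p := hP.le.trans (by exact_mod_cast not_lt.1 h)
        calc (2 : ℝ) = ((2 : ℝ) ^ (1 / ε)) ^ ε := by
              rw [← Real.rpow_mul (by norm_num), one_div, inv_mul_cancel₀ hε.ne', Real.rpow_one]
          _ ≤ _ := by gcongr
      calc ((e + 1 : ℕ) : ℝ) ≤ (2 : ℝ) ^ e := by exact_mod_cast Nat.lt_two_pow_self
        _ ≤ _ := by gcongr
  rw [Nat.card_divisors hn0]
  push_cast
  calc (∏ p ∈ n.primeFactors, ((n.factorization p : ℝ) + 1))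
      ≤ ∏ p ∈ n.primeFactors, ((if p < P then c else 1) * ((p : ℝ) ^ n.factorization p) ^ ε) := by
        refine prod_le_prod (fun p _ => by positivity) fun p hp => ?_
        exact_mod_cast key p hp
    _ = (∏ p ∈ n.primeFactors, (if p < P then c else 1)) * (n : ℝ) ^ ε := by
        rw [prod_mul_distrib]
        congr 1
        rw [Real.finsetProd_rpow _ _ fun p _ => by positivity]
        congr 1
        have := Nat.prod_factorization_pow_eq_self hn0
        conv_rhs => rw [← this]
        rw [Finsupp.prod, Nat.support_factorization]
        push_cast
        rfl
    _ ≤ c ^ P * (n : ℝ) ^ ε := by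
        gcongr
        rw [prod_ite, prod_const, prod_const_one, mul_one]
        refine pow_le_pow_right₀ hc1 ?_
        refine (card_le_card (t := range P) fun p hp => ?_).trans_eq (card_range P)
        simpa using (mem_filter.1 hp).2

lemma sq_mul_abs_le_of_mul_eq {L l d A C D P Q E₂ E₃ s : ℤ} (hl : 0 < l) (hlL : l ≤ L)
    (hA : 2 * l ≤ |A|) (hC : 2 * l ≤ |C|) (hD : 2 * l ≤ |D|) (hP : |P| ≤ l ^ 2)
    (hQ : |Q| ≤ l ^ 2) (hE₂ : |E₂| ≤ 2 * L) (hE₃ : |E₃| ≤ 4 * L ^ 2) (hs : |s| ≤ 4 * L)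
    (h : d * (3 * (A * C * D) + (A * P - C * Q)) = E₂ * (3 * C * s + P) - 4 * E₃ * C) :
    l ^ 2 * |d| ≤ 5 * L ^ 2 := by
  have hL : 0 < L := hl.trans_le hlL
  have hCpos : 0 < |C| := by linarith
  have hlC : l ^ 2 ≤ L * |C| := by
    rw [sq]
    exact mul_le_mul hlL (by linarith) hl.le hL.le
  have upper : |E₂ * (3 * C * s + P) - 4 * E₃ * C| ≤ 42 * L ^ 2 * |C| := by
    have h1 : |3 * C * s + P| ≤ 13 * L * |C| := by
      calc |3 * C * s + P| ≤ |3 * C * s| + |P| := abs_add_le _ _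
        _ = 3 * |C| * |s| + |P| := by
          rw [abs_mul, abs_mul]
          norm_num
        _ ≤ 3 * |C| * (4 * L) + L * |C| := by
          gcongr
          exact hP.trans hlC
        _ = _ := by ring
    calc |E₂ * (3 * C * s + P) - 4 * E₃ * C|
        ≤ |E₂ * (3 * C * s + P)| + |4 * E₃ * C| := abs_sub _ _
      _ = |E₂| * |3 * C * s + P| + 4 * |E₃| * |C| := by
        rw [abs_mul, abs_mul, abs_mul]
        norm_num
      _ ≤ (2 * L) * (13 * L * |C|) + 4 * (4 * L ^ 2) * |C| := by gcongr
      _ = _ := by ring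
  have lower : 10 * l ^ 2 * |C| ≤ |3 * (A * C * D) + (A * P - C * Q)| := by
    have h1 : |3 * (A * C * D)| ≤ |3 * (A * C * D) + (A * P - C * Q)| + |A * P - C * Q| := by
      have := abs_sub (3 * (A * C * D) + (A * P - C * Q)) (A * P - C * Q)
      rwa [add_sub_cancel_right] at this
    have h2 : |A * P - C * Q| ≤ |A| * l ^ 2 + |C| * l ^ 2 := by
      refine (abs_sub _ _).trans ?_
      rw [abs_mul, abs_mul]
      gcongr
    have h3 : |3 * (A * C * D)| = 3 * (|A| * |C| * |D|) := by
      rw [abs_mul, abs_mul, abs_mul]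
      norm_num
    have h4 : |A| * |C| * (2 * l) ≤ |A| * |C| * |D| := by gcongr
    have h5 : |A| * l * (2 * l) ≤ |A| * l * |C| := by gcongr
    have h6 : |C| * l * (2 * l) ≤ |C| * l * |A| := by gcongr
    nlinarith
  have h7 : (10 * (l ^ 2 * |d|)) * |C| ≤ (42 * L ^ 2) * |C| := by
    calc (10 * (l ^ 2 * |d|)) * |C| = |d| * (10 * l ^ 2 * |C|) := by ring
      _ ≤ |d| * |3 * (A * C * D) + (A * P - C * Q)| := by gcongr
      _ ≤ _ := by rw [← abs_mul, h]; exact upper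
  have h8 := le_of_mul_le_mul_right h7 hCpos
  have h9 := sq_nonneg L
  linarith

/-- If two separated triples have nearly equal power sums, then they are close. -/
lemma sq_mul_abs_sub_le {L l x₁ x₂ x₃ y₁ y₂ y₃ : ℤ} (hl : 0 < l) (hlL : l ≤ L)
    (hx₂ : 0 ≤ x₂ ∧ x₂ ≤ L) (hx₃ : 0 ≤ x₃ ∧ x₃ ≤ L) (hy₂ : 0 ≤ y₂ ∧ y₂ ≤ L)
    (hy₃ : 0 ≤ y₃ ∧ y₃ ≤ L)
    (d₁ : |x₁ - y₁| ≤ l) (d₂ : |x₂ - y₂| ≤ l) (d₃ : |x₃ - y₃| ≤ l)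
    (h₁₃ : 2 * l ≤ |(x₁ + y₁) - (x₃ + y₃)|) (h₂₃ : 2 * l ≤ |(x₂ + y₂) - (x₃ + y₃)|)
    (h₁₂ : 2 * l ≤ |(x₂ + y₂) - (x₁ + y₁)|)
    (e₁ : x₁ + x₂ + x₃ = y₁ + y₂ + y₃)
    (e₂ : |(x₁ ^ 2 + x₂ ^ 2 + x₃ ^ 2) - (y₁ ^ 2 + y₂ ^ 2 + y₃ ^ 2)| ≤ 2 * L)
    (e₃ : |(x₁ ^ 3 + x₂ ^ 3 + x₃ ^ 3) - (y₁ ^ 3 + y₂ ^ 3 + y₃ ^ 3)| ≤ 4 * L ^ 2) :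
    l ^ 2 * |x₁ - y₁| ≤ 5 * L ^ 2 := by
  have sq_le : ∀ {d : ℤ}, |d| ≤ l → d ^ 2 ≤ l ^ 2 := fun h => sq_le_sq' (abs_le.1 h).1 (abs_le.1 h).2
  have q₁ := sq_le d₁
  have q₂ := sq_le d₂
  have q₃ := sq_le d₃
  refine sq_mul_abs_le_of_mul_eq (P := (x₂ - y₂) ^ 2 - (x₃ - y₃) ^ 2)
    (Q := (x₁ - y₁) ^ 2 - (x₃ - y₃) ^ 2) (s := x₂ + y₂ + x₃ + y₃) hl hlL h₁₃ h₂₃ h₁₂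
    (abs_le.2 ⟨by linarith [sq_nonneg (x₂ - y₂)], by linarith [sq_nonneg (x₃ - y₃)]⟩)
    (abs_le.2 ⟨by linarith [sq_nonneg (x₁ - y₁)], by linarith [sq_nonneg (x₃ - y₃)]⟩) e₂ e₃
    (abs_le.2 ⟨by linarith, by linarith⟩) ?_
  have : x₃ = y₁ + y₂ + y₃ - x₁ - x₂ := by linarith
  subst this
  ring

/-- Either a sum is dominated by its largest terms, or three terms with well-separated indices are
all large. -/
lemma pow_eight_le_or_exists_separated {K : ℕ} (u : ℕ → ℝ) (hu : ∀ k, 0 ≤ u k) {f : ℝ} (hf : 0 ≤ f)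
    (h : f ≤ ∑ k ∈ range K, u k) :
    f ^ 8 ≤ 12 ^ 8 * ∑ k ∈ range K, u k ^ 8 ∨
      ∃ a ∈ range K, ∃ b ∈ range K, ∃ c ∈ range K, (a + 2 ≤ b ∨ b + 2 ≤ a) ∧
        (a + 2 ≤ c ∨ c + 2 ≤ a) ∧ (b + 2 ≤ c ∨ c + 2 ≤ b) ∧
        f ≤ 2 * K * u a ∧ f ≤ 2 * K * u b ∧ f ≤ 2 * K * u c := by
  classical
  set G := {k ∈ range K | f ≤ 2 * K * u k} with hG
  have memG : ∀ {k}, k ∈ G ↔ k ∈ range K ∧ f ≤ 2 * K * u k := by simp [hG]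
  by_cases hsep : ∃ a ∈ G, ∃ b ∈ G, ∃ c ∈ G, (a + 2 ≤ b ∨ b + 2 ≤ a) ∧
        (a + 2 ≤ c ∨ c + 2 ≤ a) ∧ (b + 2 ≤ c ∨ c + 2 ≤ b)
  · right
    obtain ⟨a, ha, b, hb, c, hc, hab, hac, hbc⟩ := hsep
    rw [memG] at ha hb hc
    exact ⟨a, ha.1, b, hb.1, c, hc.1, hab, hac, hbc, ha.2, hb.2, hc.2⟩
  left
  push Not at hsep
  have hcard : #G ≤ 6 := by
    rcases G.eq_empty_or_nonempty with h0 | ⟨a, ha⟩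
    · simp [h0]
    by_cases hb : ∃ b ∈ G, a + 2 ≤ b ∨ b + 2 ≤ a
    · obtain ⟨b, hb, hab⟩ := hb
      have : G ⊆ Icc (a - 1) (a + 1) ∪ Icc (b - 1) (b + 1) := by
        intro c hc
        have := hsep a ha b hb c hc hab
        simp only [mem_union, mem_Icc]
        omega
      refine (card_le_card this).trans ((card_union_le _ _).trans ?_)
      simp only [Nat.card_Icc]
      omega
    · push Not at hb
      have : G ⊆ Icc (a - 1) (a + 1) := by
        intro c hc
        have := hb c hc
        simp only [mem_Icc]
        omega
      refine (card_le_card this).trans ?_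
      simp only [Nat.card_Icc]
      omega
  have hsplit : f ≤ 2 * ∑ k ∈ G, u k := by
    have h1 : ∑ k ∈ range K with ¬ f ≤ 2 * K * u k, u k ≤ f / 2 := by
      rcases Nat.eq_zero_or_pos K with rfl | hK
      · simpa using by positivity
      have hK' : (0 : ℝ) < K := by exact_mod_cast hK
      calc ∑ k ∈ range K with ¬ f ≤ 2 * K * u k, u k
          ≤ ∑ k ∈ range K with ¬ f ≤ 2 * K * u k, f / (2 * K) := by
            refine sum_le_sum fun k hk => ?_
            rw [le_div_iff₀ (by positivity)]
            have := (mem_filter.1 hk).2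
            linarith
        _ ≤ ∑ k ∈ range K, f / (2 * K) :=
            sum_le_sum_of_subset_of_nonneg (filter_subset _ _) fun _ _ _ => by positivity
        _ = f / 2 := by
            rw [sum_const, card_range, nsmul_eq_mul]
            field_simp
    have h2 := sum_filter_add_sum_filter_not (range K) (fun k => f ≤ 2 * K * u k) u
    linarith
  rcases G.eq_empty_or_nonempty with h0 | hne
  · rw [h0] at hsplit
    have : f = 0 := le_antisymm (by simpa using hsplit) hf
    rw [this]
    have : 0 ≤ ∑ k ∈ range K, u k ^ 8 := sum_nonneg fun k _ => by positivity
    norm_num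
    exact this
  obtain ⟨m, hm, hmax⟩ := exists_max_image G u hne
  have h3 : f ≤ 12 * u m := by
    have h4 : ∑ k ∈ G, u k ≤ #G * u m := by
      rw [← nsmul_eq_mul]
      exact sum_le_card_nsmul _ _ _ hmax
    have h5 : (#G : ℝ) * u m ≤ 6 * u m := by
      have : (#G : ℝ) ≤ 6 := by exact_mod_cast hcard
      have := hu m
      gcongr
    linarith
  calc f ^ 8 ≤ (12 * u m) ^ 8 := by gcongr
    _ = 12 ^ 8 * u m ^ 8 := by ring
    _ ≤ _ := by
      gcongr
      exact single_le_sum (f := fun k => u k ^ 8) (fun k _ => by positivity) (memG.1 hm).1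

/-- The interval `[m, m + D)`. -/
noncomputable def iv (m : ℤ) (D : ℕ) : Finset ℤ := Ico m (m + D)

/-- The weight detecting `|Q| ≤ L` and `|C| ≤ 2 L ^ 2`. -/
noncomputable def wt {B : ℕ} (L : ℕ) (ψ : Dual B) : ℝ :=
  ‖expSum (range (2 * L) ×ˢ range (4 * L ^ 2)) (fun p : ℕ × ℕ => (0, (p.1 : ℤ), (p.2 : ℤ))) ψ‖ ^ 2

lemma wt_nonneg {B : ℕ} (L : ℕ) (ψ : Dual B) : 0 ≤ wt L ψ := by
  unfold wt
  positivity

lemma expSum_iv_mul {B : ℕ} (m : ℤ) (K l : ℕ) (ψ : Dual B) :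
    expSum (iv m (K * l)) mom ψ = ∑ k ∈ range K, expSum (iv (m + k * l) l) mom ψ := by
  unfold expSum iv
  induction K with
  | zero => simp
  | succ K ih =>
    rw [sum_range_succ, ← ih]
    have h1 : m ≤ m + ((K * l : ℕ) : ℤ) := by
      have := Nat.zero_le (K * l)
      omega
    have h2 : m + ((K * l : ℕ) : ℤ) ≤ m + (((K + 1) * l : ℕ) : ℤ) := by
      have : K * l ≤ (K + 1) * l := by gcongr; omega
      omega
    rw [← Ico_union_Ico_eq_Ico h1 h2, sum_union (Ico_disjoint_Ico_consecutive _ _ _)]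
    push_cast
    ring_nf

lemma card_iv (m : ℤ) (D : ℕ) : #(iv m D) = D := by
  simp [iv]

lemma mem_iv_bounds {m x : ℤ} {l L : ℕ} (hm : 0 ≤ m) (hmL : m + l ≤ L) (hx : x ∈ iv m l) :
    0 ≤ x ∧ x ≤ L := by
  simp only [iv, mem_Ico] at hx
  constructor <;> linarith

lemma sq_diff_le {x y L : ℤ} (hx : 0 ≤ x ∧ x ≤ L) (hy : 0 ≤ y ∧ y ≤ L) (k : ℕ) :
    |x ^ k - y ^ k| ≤ L ^ k := by
  have h1 := pow_le_pow_left₀ hx.1 hx.2 k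
  have h2 := pow_le_pow_left₀ hy.1 hy.2 k
  have h3 := pow_nonneg hx.1 k
  have h4 := pow_nonneg hy.1 k
  exact abs_le.2 ⟨by linarith, by linarith⟩

lemma mean_wt_le {B L : ℕ} (hB : 100 * L ^ 3 ≤ B) : mean (B := B) (wt L) ≤ 8 * L ^ 3 := by
  have hLL : L ≤ L ^ 3 := Nat.le_self_pow (by norm_num) L
  have hLL2 : L ^ 2 ≤ L ^ 3 := by
    rcases Nat.eq_zero_or_pos L with rfl | h
    · simp
    · exact Nat.pow_le_pow_right h (by norm_num)
  unfold wt
  rw [mean_norm_sq]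
  · have : coinc (range (2 * L) ×ˢ range (4 * L ^ 2)) (fun p : ℕ × ℕ => ((0 : ℤ), (p.1 : ℤ), (p.2 : ℤ)))
      (range (2 * L) ×ˢ range (4 * L ^ 2)) (fun p : ℕ × ℕ => ((0 : ℤ), (p.1 : ℤ), (p.2 : ℤ)))
        ≤ #(range (2 * L) ×ˢ range (4 * L ^ 2)) := by
      unfold coinc
      refine card_le_card_of_injOn Prod.fst (fun p hp => ?_) ?_
      · simp only [coe_filter, mem_product, Set.mem_ofPred_eq] at hp
        simpa using hp.1.1
      · rintro ⟨p, q⟩ hp ⟨p', q'⟩ hp' h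
        simp only [coe_filter, Set.mem_ofPred_eq, Prod.mk.injEq, Nat.cast_inj] at hp hp' h
        ext <;> simp <;> grind
    rw [card_product, card_range, card_range] at this
    have h2 : ((2 * L * (4 * L ^ 2) : ℕ) : ℝ) = 8 * L ^ 3 := by push_cast; ring
    rw [← h2]
    exact_mod_cast this
  · rintro ⟨a, b⟩ h1 ⟨a', b'⟩ h2
    simp only [mem_product, mem_range] at h1 h2
    refine ⟨?_, ?_, ?_⟩ <;> simp only [Prod.fst_sub, Prod.snd_sub, sub_zero, abs_le] <;>
      constructor <;> omega

lemma mean_trilinear_le {B L l q : ℕ} (hB : 100 * L ^ 3 ≤ B) (hl : 0 < l) (hq : 0 < q)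
    (hL : L = q * l) {m₁ m₂ m₃ : ℤ} (h₁ : 0 ≤ m₁ ∧ m₁ + l ≤ L) (h₂ : 0 ≤ m₂ ∧ m₂ + l ≤ L)
    (h₃ : 0 ≤ m₃ ∧ m₃ + l ≤ L) (h₁₂ : m₁ + 2 * l ≤ m₂ ∨ m₂ + 2 * l ≤ m₁)
    (h₁₃ : m₁ + 2 * l ≤ m₃ ∨ m₃ + 2 * l ≤ m₁) (h₂₃ : m₂ + 2 * l ≤ m₃ ∨ m₃ + 2 * l ≤ m₂) :
    mean (B := B) (fun ψ => (‖expSum (iv m₁ l) mom ψ‖ * ‖expSum (iv m₂ l) mom ψ‖ *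
      ‖expSum (iv m₃ l) mom ψ‖) ^ 2 * wt L ψ) ≤ 968 * l ^ 3 * q ^ 4 * L ^ 3 := by
  have hLpos : 0 < L := hL ▸ Nat.mul_pos hq hl
  have hlL : (l : ℤ) ≤ L := by rw [hL]; exact_mod_cast Nat.le_mul_of_pos_left l hq
  have hLL : L ≤ L ^ 3 := Nat.le_self_pow (by norm_num) L
  have hLL2 : L ^ 2 ≤ L ^ 3 := Nat.pow_le_pow_right hLpos (by norm_num)
  set W := range (2 * L) ×ˢ range (4 * L ^ 2) with hW
  set κ : ℕ × ℕ → ℤ × ℤ × ℤ := fun p => (0, (p.1 : ℤ), (p.2 : ℤ)) with hκ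
  set T := (iv m₁ l ×ˢ iv m₂ l) ×ˢ (iv m₃ l ×ˢ W) with hT
  set v : (ℤ × ℤ) × (ℤ × (ℕ × ℕ)) → ℤ × ℤ × ℤ :=
    fun p => (mom p.1.1 + mom p.1.2) + (mom p.2.1 + κ p.2.2) with hv
  have hprod : (fun ψ : Dual B => (‖expSum (iv m₁ l) mom ψ‖ * ‖expSum (iv m₂ l) mom ψ‖ *
      ‖expSum (iv m₃ l) mom ψ‖) ^ 2 * wt L ψ) = fun ψ => ‖expSum T v ψ‖ ^ 2 := by
    have e := expSum_product (B := B) (iv m₁ l ×ˢ iv m₂ l) (fun p => mom p.1 + mom p.2)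
      (iv m₃ l ×ˢ W) (fun p => mom p.1 + κ p.2)
    have e1 := expSum_product (B := B) (iv m₁ l) mom (iv m₂ l) mom
    have e2 := expSum_product (B := B) (iv m₃ l) mom W κ
    funext ψ
    rw [congrFun e ψ, congrFun e1 ψ, congrFun e2 ψ]
    simp only [norm_mul, wt]
    ring
  rw [hprod, mean_norm_sq]
  · set R : ℕ := 5 * q ^ 2 with hR
    have hinj : coinc T v T v ≤ #(T ×ˢ (Icc (-(R : ℤ)) R ×ˢ Icc (-(R : ℤ)) R)) := by
      unfold coinc
      refine card_le_card_of_injOn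
        (fun z => (z.1, (z.1.1.1 - z.2.1.1, z.1.1.2 - z.2.1.2))) (fun z hz => ?_) ?_
      · obtain ⟨⟨⟨x₁, x₂⟩, x₃, h, k⟩, ⟨y₁, y₂⟩, y₃, h', k'⟩ := z
        simp only [hT, hW, hv, hκ, mom, coe_filter, mem_product, mem_range, Set.mem_ofPred_eq, Prod.mk_add_mk,
          Prod.mk.injEq] at hz
        obtain ⟨⟨⟨⟨a₁, a₂⟩, a₃, a₄, a₅⟩, ⟨b₁, b₂⟩, b₃, b₄, b₅⟩, f₁, f₂, f₃⟩ := hz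
        have A₁ := mem_iv_bounds h₁.1 h₁.2 a₁
        have A₂ := mem_iv_bounds h₂.1 h₂.2 a₂
        have A₃ := mem_iv_bounds h₃.1 h₃.2 a₃
        have B₁ := mem_iv_bounds h₁.1 h₁.2 b₁
        have B₂ := mem_iv_bounds h₂.1 h₂.2 b₂
        have B₃ := mem_iv_bounds h₃.1 h₃.2 b₃
        have conv : ∀ d : ℤ, (l : ℤ) ^ 2 * |d| ≤ 5 * (L : ℤ) ^ 2 → d ∈ Icc (-(R : ℤ)) R := by
          intro d hd
          have : |d| ≤ R := by
            have hl2 : (0 : ℤ) < (l : ℤ) ^ 2 := by positivity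
            refine le_of_mul_le_mul_left (hd.trans_eq ?_) hl2
            rw [hR, hL]
            push_cast
            ring
          rw [mem_Icc]
          exact abs_le.1 this
        have c₁ : (l : ℤ) ^ 2 * |x₁ - y₁| ≤ 5 * (L : ℤ) ^ 2 := by
          simp only [iv, mem_Ico] at a₁ a₂ a₃ b₁ b₂ b₃
          refine sq_mul_abs_sub_le (x₂ := x₂) (x₃ := x₃) (y₂ := y₂) (y₃ := y₃)
            (by exact_mod_cast hl) hlL A₂ A₃ B₂ B₃ ?_ ?_ ?_ ?_ ?_ ?_ ?_ ?_ ?_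
          all_goals try (simp only [abs_le, le_abs]; omega)
          · linarith
          · rw [abs_le]; constructor <;> linarith
        have c₂ : (l : ℤ) ^ 2 * |x₂ - y₂| ≤ 5 * (L : ℤ) ^ 2 := by
          simp only [iv, mem_Ico] at a₁ a₂ a₃ b₁ b₂ b₃
          refine sq_mul_abs_sub_le (x₂ := x₁) (x₃ := x₃) (y₂ := y₁) (y₃ := y₃)
            (by exact_mod_cast hl) hlL A₁ A₃ B₁ B₃ ?_ ?_ ?_ ?_ ?_ ?_ ?_ ?_ ?_
          all_goals try (simp only [abs_le, le_abs]; omega)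
          · linarith
          · rw [abs_le]; constructor <;> linarith
        simp only [hT, coe_product, Set.mem_prod, mem_coe, hW]
        simp only [mem_range]
        exact ⟨⟨⟨a₁, a₂⟩, a₃, a₄, a₅⟩, conv _ c₁, conv _ c₂⟩
      · rintro ⟨⟨⟨x₁, x₂⟩, x₃, h, k⟩, ⟨y₁, y₂⟩, y₃, h', k'⟩ hz
          ⟨⟨⟨x₁', x₂'⟩, x₃', g, i⟩, ⟨y₁', y₂'⟩, y₃', g', i'⟩ hz' he
        simp only [hv, hκ, mom, coe_filter, Set.mem_ofPred_eq, Prod.mk_add_mk,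
          Prod.mk.injEq] at hz hz' he
        obtain ⟨-, f₁, f₂, f₃⟩ := hz
        obtain ⟨-, g₁, g₂, g₃⟩ := hz'
        obtain ⟨⟨⟨rfl, rfl⟩, rfl, rfl, rfl⟩, d₁, d₂⟩ := he
        obtain rfl : y₁ = y₁' := by linarith
        obtain rfl : y₂ = y₂' := by linarith
        obtain rfl : y₃ = y₃' := by linarith
        obtain rfl : h' = g' := by zify; linarith
        obtain rfl : k' = i' := by zify; linarith
        rfl
    have hcard : #(T ×ˢ (Icc (-(R : ℤ)) R ×ˢ Icc (-(R : ℤ)) R))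
        = l ^ 3 * (8 * L ^ 3) * (2 * R + 1) ^ 2 := by
      have : (Icc (-(R : ℤ)) R).card = 2 * R + 1 := by
        rw [Int.card_Icc]
        omega
      simp only [hT, hW, card_product, card_iv, card_range, this]
      ring
    have hR' : 2 * R + 1 ≤ 11 * q ^ 2 := by
      have : 0 < q ^ 2 := by positivity
      omega
    have : coinc T v T v ≤ 968 * l ^ 3 * q ^ 4 * L ^ 3 := by
      calc coinc T v T v ≤ l ^ 3 * (8 * L ^ 3) * (2 * R + 1) ^ 2 := hcard ▸ hinj
        _ ≤ l ^ 3 * (8 * L ^ 3) * (11 * q ^ 2) ^ 2 := by gcongr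
        _ = _ := by ring
    exact_mod_cast this
  · rintro ⟨⟨x₁, x₂⟩, x₃, h, k⟩ hz ⟨⟨y₁, y₂⟩, y₃, h', k'⟩ hz'
    simp only [hT, hW, mem_product, mem_range] at hz hz'
    obtain ⟨⟨a₁, a₂⟩, a₃, a₄, a₅⟩ := hz
    obtain ⟨⟨b₁, b₂⟩, b₃, b₄, b₅⟩ := hz'
    have D₁ := sq_diff_le (mem_iv_bounds h₁.1 h₁.2 a₁) (mem_iv_bounds h₁.1 h₁.2 b₁)
    have D₂ := sq_diff_le (mem_iv_bounds h₂.1 h₂.2 a₂) (mem_iv_bounds h₂.1 h₂.2 b₂)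
    have D₃ := sq_diff_le (mem_iv_bounds h₃.1 h₃.2 a₃) (mem_iv_bounds h₃.1 h₃.2 b₃)
    simp only [abs_le] at D₁ D₂ D₃
    zify at hB hLL hLL2 a₄ a₅ b₄ b₅ hLpos
    simp only [InBox, hv, hκ, mom, Prod.mk_add_mk, Prod.mk_sub_mk, abs_le]
    refine ⟨?_, ?_, ?_⟩
    · have := D₁ 1; have := D₂ 1; have := D₃ 1
      simp only [pow_one] at *
      constructor <;> linarith
    · have := D₁ 2; have := D₂ 2; have := D₃ 2
      constructor <;> linarith
    · have := D₁ 3; have := D₂ 3; have := D₃ 3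
      constructor <;> linarith

/-- Triples of indices below `K` that pairwise differ by at least two. -/
def sepTriples (K : ℕ) : Finset (ℕ × ℕ × ℕ) :=
  {p ∈ range K ×ˢ range K ×ˢ range K | (p.1 + 2 ≤ p.2.1 ∨ p.2.1 + 2 ≤ p.1) ∧
    (p.1 + 2 ≤ p.2.2 ∨ p.2.2 + 2 ≤ p.1) ∧ (p.2.1 + 2 ≤ p.2.2 ∨ p.2.2 + 2 ≤ p.2.1)}

lemma pow_eight_le_add {K : ℕ} (u : ℕ → ℝ) (hu : ∀ k, 0 ≤ u k) {f M : ℝ} (hf : 0 ≤ f)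
    (h : f ≤ ∑ k ∈ range K, u k) (hM : f ≤ M) :
    f ^ 8 ≤ 12 ^ 8 * ∑ k ∈ range K, u k ^ 8 +
      (2 * K) ^ 6 * M ^ 2 * ∑ p ∈ sepTriples K, (u p.1 * u p.2.1 * u p.2.2) ^ 2 := by
  have n1 : 0 ≤ ∑ k ∈ range K, u k ^ 8 := sum_nonneg fun k _ => by have := hu k; positivity
  have n2 : 0 ≤ ∑ p ∈ sepTriples K, (u p.1 * u p.2.1 * u p.2.2) ^ 2 :=
    sum_nonneg fun k _ => by positivity
  rcases pow_eight_le_or_exists_separated u hu hf h with h | h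
  · exact h.trans (le_add_of_nonneg_right (by positivity))
  · obtain ⟨a, ha, b, hb, c, hc, hab, hac, hbc, fa, fb, fc⟩ := h
    have hmem : (a, b, c) ∈ sepTriples K := by
      simp only [sepTriples, mem_filter, mem_product]
      exact ⟨⟨ha, hb, hc⟩, hab, hac, hbc⟩
    have h1 : (u a * u b * u c) ^ 2 ≤ ∑ p ∈ sepTriples K, (u p.1 * u p.2.1 * u p.2.2) ^ 2 :=
      single_le_sum (f := fun p : ℕ × ℕ × ℕ => (u p.1 * u p.2.1 * u p.2.2) ^ 2)
        (fun p _ => sq_nonneg _) hmem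
    have ua := hu a
    have ub := hu b
    have uc := hu c
    have h2 : f ^ 8 ≤ (2 * K) ^ 6 * M ^ 2 * (u a * u b * u c) ^ 2 := by
      calc f ^ 8 = (f * f * f) ^ 2 * f ^ 2 := by ring
        _ ≤ ((2 * K * u a) * (2 * K * u b) * (2 * K * u c)) ^ 2 * M ^ 2 := by gcongr
        _ = _ := by ring
    refine (h2.trans (mul_le_mul_of_nonneg_left h1 (by positivity))).trans
      (le_add_of_nonneg_left (by positivity))

/-- One step of the induction on scales. -/
lemma mean_pow_eight_step {B L l q K : ℕ} {M : ℝ} (hB : 100 * L ^ 3 ≤ B) (hl : 0 < l) (hq : 0 < q)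
    (hL : L = q * l) (hM : ∀ m : ℤ, 0 ≤ m → m + l ≤ L →
      mean (B := B) (fun ψ => ‖expSum (iv m l) mom ψ‖ ^ 8 * wt L ψ) ≤ M) {m : ℤ} (hm : 0 ≤ m)
    (hmL : m + (K * l : ℕ) ≤ L) :
    mean (B := B) (fun ψ => ‖expSum (iv m (K * l)) mom ψ‖ ^ 8 * wt L ψ) ≤
      12 ^ 8 * (K * M) +
        (2 * K) ^ 6 * (K * l) ^ 2 * (K ^ 3 * (968 * l ^ 3 * q ^ 4 * L ^ 3)) := by
  set u : ℕ → Dual B → ℝ := fun k ψ => ‖expSum (iv (m + k * l) l) mom ψ‖ with hu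
  have hval : ∀ k ∈ range K, 0 ≤ m + k * l ∧ m + k * l + l ≤ L := by
    intro k hk
    have : (k + 1) * l ≤ K * l := Nat.mul_le_mul_right _ (mem_range.1 hk)
    zify at this
    push_cast at hmL
    constructor
    · positivity
    · linarith
  have hpt : ∀ ψ : Dual B, ‖expSum (iv m (K * l)) mom ψ‖ ^ 8 * wt L ψ ≤
      12 ^ 8 * ∑ k ∈ range K, u k ψ ^ 8 * wt L ψ +
        (2 * K) ^ 6 * (K * l) ^ 2 *
          ∑ p ∈ sepTriples K, (u p.1 ψ * u p.2.1 ψ * u p.2.2 ψ) ^ 2 * wt L ψ := by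
    intro ψ
    rw [← sum_mul, ← sum_mul, ← mul_assoc, ← mul_assoc, ← add_mul]
    refine mul_le_mul_of_nonneg_right (pow_eight_le_add (fun k => u k ψ) (fun k => norm_nonneg _)
      (norm_nonneg _) ?_ ?_) (wt_nonneg L ψ)
    · rw [expSum_iv_mul]
      exact norm_sum_le _ _
    · have := norm_expSum_le (iv m (K * l)) mom ψ
      rw [card_iv] at this
      exact_mod_cast this
  refine (mean_mono hpt).trans ?_
  rw [mean_add, mean_const_mul, mean_const_mul, mean_sum, mean_sum]
  have s1 : ∑ k ∈ range K, mean (fun ψ : Dual B => u k ψ ^ 8 * wt L ψ) ≤ K * M := by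
    refine (sum_le_card_nsmul _ _ M fun k hk => hM _ (hval k hk).1 (hval k hk).2).trans_eq ?_
    rw [card_range, nsmul_eq_mul]
  have s2 : ∑ p ∈ sepTriples K, mean (fun ψ : Dual B => (u p.1 ψ * u p.2.1 ψ * u p.2.2 ψ) ^ 2 * wt L ψ) ≤
      K ^ 3 * (968 * l ^ 3 * q ^ 4 * L ^ 3) := by
    have hcard : (#(sepTriples K) : ℝ) ≤ K ^ 3 := by
      have : #(sepTriples K) ≤ K ^ 3 := by
        refine (card_filter_le _ _).trans_eq ?_
        simp only [card_product, card_range]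
        ring
      exact_mod_cast this
    refine (sum_le_card_nsmul _ _ ((968 : ℝ) * l ^ 3 * q ^ 4 * L ^ 3) fun p hp => ?_).trans ?_
    · simp only [sepTriples, mem_filter, mem_product] at hp
      obtain ⟨⟨ha, hb, hc⟩, hab, hac, hbc⟩ := hp
      have sep : ∀ {a b : ℕ}, (a + 2 ≤ b ∨ b + 2 ≤ a) →
          (m + a * l + 2 * l ≤ m + b * l ∨ m + b * l + 2 * l ≤ m + a * l) := by
        intro a b h
        refine h.imp (fun h => ?_) fun h => ?_
        all_goals
          have := Nat.mul_le_mul_right l h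
          zify at this
          linarith
      exact mean_trilinear_le hB hl hq hL (hval _ ha) (hval _ hb) (hval _ hc) (sep hab) (sep hac)
        (sep hbc)
    · rw [nsmul_eq_mul]
      gcongr
  gcongr

/-- The constant in `mean_pow_eight_le`. -/
noncomputable def scaleConst (K : ℕ) : ℝ := K ^ 3 * (2 * K) ^ 6 * K ^ 2 * 968

lemma mean_pow_eight_le {K J B : ℕ} (hK : 2 ≤ K) (hB : 100 * (K ^ J) ^ 3 ≤ B) :
    ∀ j ≤ J, ∀ m : ℤ, 0 ≤ m → m + (K ^ j : ℕ) ≤ (K ^ J : ℕ) →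
      mean (B := B) (fun ψ => ‖expSum (iv m (K ^ j)) mom ψ‖ ^ 8 * wt (K ^ J) ψ) ≤
        scaleConst K * (K ^ J) ^ 7 * K ^ j * (2 * 12 ^ 8) ^ j := by
  have hK' : (2 : ℝ) ≤ K := by exact_mod_cast hK
  have hKpos : 0 < K := by omega
  have hL : (1 : ℝ) ≤ (K : ℝ) ^ J := one_le_pow₀ (by linarith)
  have hK1 : (1 : ℝ) ≤ K := by linarith
  have hA : 8 ≤ scaleConst K := by
    unfold scaleConst
    calc (8 : ℝ) ≤ 1 ^ 3 * (2 * 1) ^ 6 * 1 ^ 2 * 968 := by norm_num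
      _ ≤ _ := by gcongr
  intro j
  induction j with
  | zero =>
    intro _ m _ _
    have h1 : ∀ ψ : Dual B, ‖expSum (iv m (K ^ 0)) mom ψ‖ ^ 8 * wt (K ^ J) ψ ≤ wt (K ^ J) ψ := by
      intro ψ
      have h2 : ‖expSum (iv m (K ^ 0)) mom ψ‖ ≤ 1 := by
        have := norm_expSum_le (iv m (K ^ 0)) mom ψ
        rw [card_iv] at this
        simpa using this
      exact mul_le_of_le_one_left (wt_nonneg _ _) (pow_le_one₀ (norm_nonneg _) h2)
    refine (mean_mono h1).trans ((mean_wt_le hB).trans ?_)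
    simp only [pow_zero, mul_one, Nat.cast_pow]
    gcongr
    norm_num
  | succ j ih =>
    intro hj m hm hmL
    have hstep := mean_pow_eight_step (K := K) (q := K ^ (J - j)) hB (pow_pos hKpos j)
      (pow_pos hKpos (J - j)) (by rw [← pow_add]; congr 1; omega)
      (ih (by omega)) hm (by rw [← pow_succ']; exact hmL)
    rw [← pow_succ'] at hstep
    refine hstep.trans ?_
    push_cast
    have e : (2 * K : ℝ) ^ 6 * (K * K ^ j) ^ 2 *
        (K ^ 3 * (968 * (K ^ j) ^ 3 * (K ^ (J - j)) ^ 4 * (K ^ J) ^ 3)) =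
          scaleConst K * (K ^ J) ^ 7 * K ^ j := by
      have : (K : ℝ) ^ J = K ^ (J - j) * K ^ j := by rw [← pow_add]; congr 1; omega
      rw [this, scaleConst]
      ring
    rw [e]
    have hA0 : 0 ≤ scaleConst K := by linarith
    have hX : 0 ≤ scaleConst K * (K ^ J) ^ 7 * (K : ℝ) ^ j := by positivity
    have h3 : (1 : ℝ) ≤ (2 * 12 ^ 8) ^ j := one_le_pow₀ (by norm_num)
    have h4 : scaleConst K * (K ^ J) ^ 7 * (K : ℝ) ^ j ≤
        12 ^ 8 * (K * (scaleConst K * (K ^ J) ^ 7 * (K : ℝ) ^ j * (2 * 12 ^ 8) ^ j)) := by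
      have hY := mul_le_mul_of_nonneg_left h3 hX
      have h5 : 0 ≤ scaleConst K * (K ^ J) ^ 7 * (K : ℝ) ^ j * (2 * 12 ^ 8) ^ j := by positivity
      have h6 := mul_le_mul_of_nonneg_right hK1 h5
      linarith
    refine (add_le_add_right h4 _).trans_eq ?_
    ring

/-- Pairs of quadruples from `S` with equal sums, nearly equal sums of squares and nearly equal sums
of cubes. -/
def nearPairs (S : Finset ℤ) (X Y : ℤ) : Finset ((Fin 4 → ℤ) × (Fin 4 → ℤ)) :=
  {p ∈ tup 4 S ×ˢ tup 4 S | (ps p.1 - ps p.2).1 = 0 ∧ |(ps p.1 - ps p.2).2.1| ≤ X ∧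
    |(ps p.1 - ps p.2).2.2| ≤ Y}

lemma mem_nearPairs {S : Finset ℤ} {X Y : ℤ} {p : (Fin 4 → ℤ) × (Fin 4 → ℤ)} :
    p ∈ nearPairs S X Y ↔ (p.1 ∈ tup 4 S ∧ p.2 ∈ tup 4 S) ∧ (ps p.1 - ps p.2).1 = 0 ∧
      |(ps p.1 - ps p.2).2.1| ≤ X ∧ |(ps p.1 - ps p.2).2.2| ≤ Y := by
  simp [nearPairs]

lemma nearPairs_mono {S S' : Finset ℤ} {X X' Y Y' : ℤ} (hS : S ⊆ S') (hX : X ≤ X') (hY : Y ≤ Y') :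
    nearPairs S X Y ⊆ nearPairs S' X' Y' := by
  intro p hp
  simp only [mem_nearPairs, mem_tup] at hp ⊢
  exact ⟨⟨fun i => hS (hp.1.1 i), fun i => hS (hp.1.2 i)⟩, hp.2.1, hp.2.2.1.trans hX,
    hp.2.2.2.trans hY⟩

lemma card_nearPairs_mul_le (B L : ℕ) (S : Finset ℤ) :
    (#(nearPairs S L (2 * L ^ 2)) : ℝ) * (L * (2 * L ^ 2)) ≤
      mean (B := B) (fun ψ => ‖expSum S mom ψ‖ ^ 8 * wt L ψ) := by
  set W := range (2 * L) ×ˢ range (4 * L ^ 2) with hW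
  set κ : ℕ × ℕ → ℤ × ℤ × ℤ := fun p => (0, (p.1 : ℤ), (p.2 : ℤ)) with hκ
  set T := tup 4 S ×ˢ W with hT
  set v : (Fin 4 → ℤ) × ℕ × ℕ → ℤ × ℤ × ℤ := fun p => ps p.1 + κ p.2 with hv
  have h1 : (fun ψ : Dual B => ‖expSum S mom ψ‖ ^ 8 * wt L ψ) =
      fun ψ => ‖expSum T v ψ‖ * ‖expSum T v ψ‖ := by
    funext ψ
    rw [congrFun (expSum_product (tup 4 S) ps W κ) ψ, expSum_tup, norm_mul, norm_pow, wt]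
    ring
  rw [h1]
  refine le_trans ?_ (coinc_le_mean T v T v)
  have h2 : #(nearPairs S L (2 * L ^ 2) ×ˢ (range L ×ˢ range (2 * L ^ 2))) ≤ coinc T v T v := by
    unfold coinc
    refine card_le_card_of_injOn (fun z =>
      ((z.1.1, (z.2.1 + (-(ps z.1.1 - ps z.1.2).2.1).toNat,
          z.2.2 + (-(ps z.1.1 - ps z.1.2).2.2).toNat)),
        (z.1.2, (z.2.1 + ((ps z.1.1 - ps z.1.2).2.1).toNat,
          z.2.2 + ((ps z.1.1 - ps z.1.2).2.2).toNat)))) (fun z hz => ?_) ?_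
    · obtain ⟨⟨t, t'⟩, i, j⟩ := z
      simp only [coe_product, Set.mem_prod, mem_coe, mem_nearPairs, mem_range] at hz
      obtain ⟨⟨⟨ht, ht'⟩, e₁, e₂, e₃⟩, hi, hj⟩ := hz
      simp only [hT, hW, hv, hκ, coe_filter, mem_product, mem_range, Set.mem_ofPred_eq]
      rw [abs_le] at e₂ e₃
      refine ⟨⟨⟨ht, ?_, ?_⟩, ht', ?_, ?_⟩, ?_⟩
      · omega
      · zify
        rw [Int.toNat_eq_max]
        zify at hj
        rcases max_cases (-(ps t - ps t').2.2) 0 with h | h <;> linarith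
      · omega
      · zify
        rw [Int.toNat_eq_max]
        zify at hj
        rcases max_cases ((ps t - ps t').2.2) 0 with h | h <;> linarith
      · simp only [Prod.fst_sub, Prod.snd_sub] at e₁ e₂ e₃ ⊢
        refine Prod.ext ?_ (Prod.ext ?_ ?_) <;>
          simp only [Prod.fst_add, Prod.snd_add] <;> omega
    · rintro ⟨⟨t, t'⟩, i, j⟩ _ ⟨⟨s, s'⟩, i', j'⟩ _ h
      simp only [Prod.mk.injEq] at h
      obtain ⟨⟨rfl, h1, h2⟩, rfl, -, -⟩ := h
      simp only [add_left_inj] at h1 h2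
      rw [h1, h2]
  rw [card_product, card_product, card_range, card_range] at h2
  exact_mod_cast h2

lemma card_nearPairs_iv_le {K : ℕ} (hK : 2 ≤ K) (J : ℕ) :
    (#(nearPairs (iv 0 (K ^ J)) (K ^ J : ℕ) (2 * (K ^ J : ℕ) ^ 2)) : ℝ) ≤
      scaleConst K * (K ^ J) ^ 5 * (2 * 12 ^ 8) ^ J := by
  have h1 := card_nearPairs_mul_le (100 * (K ^ J) ^ 3) (K ^ J) (iv 0 (K ^ J))
  have h2 := h1.trans (mean_pow_eight_le hK le_rfl J le_rfl 0 le_rfl (by simp))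
  have hK' : (0 : ℝ) < K := by exact_mod_cast (by omega : 0 < K)
  have hL : (0 : ℝ) < (K : ℝ) ^ J := by positivity
  push_cast at h2 ⊢
  refine le_of_mul_le_mul_right (h2.trans ?_) (by positivity : (0 : ℝ) < K ^ J * (2 * (K ^ J) ^ 2))
  have h3 : 0 ≤ scaleConst K * (K ^ J) ^ 7 * (K : ℝ) ^ J * (2 * 12 ^ 8) ^ J := by
    unfold scaleConst
    positivity
  linarith

/-- Almost optimal bound for the number of pairs of quadruples with equal sums, sums of squares
within `O(N)` and sums of cubes within `O(N ^ 2)`. -/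
lemma exists_card_nearPairs_le {ε : ℝ} (hε : 0 < ε) : ∃ C : ℝ, 0 ≤ C ∧ ∀ N : ℕ, 1 ≤ N →
    (#(nearPairs (Icc 1 (2 * N)) (2 * N) (6 * N ^ 2)) : ℝ) ≤ C * (N : ℝ) ^ (5 + ε) := by
  obtain ⟨K, hK, hKε⟩ : ∃ K : ℕ, 2 ≤ K ∧ (2 * 12 ^ 8 : ℝ) ≤ (K : ℝ) ^ ε := by
    have h := ((tendsto_rpow_atTop hε).comp tendsto_natCast_atTop_atTop).eventually_ge_atTop
      (2 * 12 ^ 8 : ℝ)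
    obtain ⟨K, h1, h2⟩ := (h.and (Filter.eventually_ge_atTop 2)).exists
    exact ⟨K, h2, h1⟩
  have hA : 0 ≤ scaleConst K := by
    unfold scaleConst
    positivity
  refine ⟨scaleConst K * (2 * K) ^ (5 + ε), by positivity, fun N hN => ?_⟩
  set J := Nat.log K (2 * N) + 1 with hJ
  have hlt : 2 * N < K ^ J := Nat.lt_pow_succ_log_self (by omega) _
  have hle : K ^ J ≤ 2 * N * K := by
    rw [hJ, pow_succ]
    exact Nat.mul_le_mul_right _ (Nat.pow_log_le_self K (by omega))
  have hsub : nearPairs (Icc 1 (2 * N)) (2 * N) (6 * N ^ 2) ⊆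
      nearPairs (iv 0 (K ^ J)) (K ^ J : ℕ) (2 * (K ^ J : ℕ) ^ 2) := by
    zify at hlt
    apply nearPairs_mono
    · intro x hx
      simp only [iv, mem_Ico, mem_Icc] at hx ⊢
      push_cast
      omega
    · push_cast
      omega
    · push_cast
      nlinarith
  have h1 : (#(nearPairs (Icc 1 (2 * N)) (2 * N) (6 * N ^ 2)) : ℝ) ≤ _ :=
    (Nat.cast_le.2 (card_le_card hsub)).trans (card_nearPairs_iv_le hK J)
  refine h1.trans ?_
  have hLpos : (0 : ℝ) < (K : ℝ) ^ J := by positivity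
  have h2 : ((2 : ℝ) * 12 ^ 8) ^ J ≤ ((K : ℝ) ^ J) ^ ε := by
    calc ((2 : ℝ) * 12 ^ 8) ^ J ≤ ((K : ℝ) ^ ε) ^ J := by gcongr
      _ = ((K : ℝ) ^ J) ^ ε := by
        rw [← Real.rpow_natCast, ← Real.rpow_mul (by positivity), ← Real.rpow_natCast,
          ← Real.rpow_mul (by positivity), mul_comm]
  have h3 : ((K : ℝ) ^ J) ^ 5 * ((K : ℝ) ^ J) ^ ε = ((K : ℝ) ^ J) ^ (5 + ε) := by
    rw [Real.rpow_add hLpos]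
    congr 1
    exact_mod_cast (Real.rpow_natCast ((K : ℝ) ^ J) 5).symm
  calc scaleConst K * ((K : ℝ) ^ J) ^ 5 * (2 * 12 ^ 8) ^ J
      ≤ scaleConst K * ((K : ℝ) ^ J) ^ 5 * ((K : ℝ) ^ J) ^ ε := by gcongr
    _ = scaleConst K * ((K : ℝ) ^ J) ^ (5 + ε) := by rw [mul_assoc, h3]
    _ ≤ scaleConst K * (2 * K * N) ^ (5 + ε) := by
      have : (K : ℝ) ^ J ≤ 2 * K * N := by
        calc (K : ℝ) ^ J ≤ 2 * N * K := by exact_mod_cast hle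
          _ = _ := by ring
      gcongr
    _ = _ := by rw [Real.mul_rpow (by positivity) (by positivity), mul_assoc]

lemma coinc_le_sum {τ σ ι : Type*} {T : Finset τ} {v : τ → ℤ × ℤ × ℤ} {S : Finset σ}
    {w : σ → ℤ × ℤ × ℤ} (A : Finset ι) (T' : ι → Finset τ) (S' : ι → Finset σ)
    (h : ∀ t ∈ T, ∀ s ∈ S, v t = w s → ∃ i ∈ A, t ∈ T' i ∧ s ∈ S' i) :
    coinc T v S w ≤ ∑ i ∈ A, coinc (T' i) v (S' i) w := by
  classical
  unfold coinc
  refine (card_le_card ?_).trans (card_biUnion_le (s := A)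
    (t := fun i => {p ∈ T' i ×ˢ S' i | v p.1 = w p.2}))
  intro p hp
  simp only [mem_filter, mem_product, mem_biUnion] at hp ⊢
  obtain ⟨i, hi, h1, h2⟩ := h _ hp.1.1 _ hp.1.2 hp.2
  exact ⟨i, hi, ⟨h1, h2⟩, hp.2⟩

/-- The effect of the substitution `n ↦ r + q n` on power sums of `k`-tuples. -/
def aff (k : ℕ) (r q : ℤ) (z : ℤ × ℤ × ℤ) : ℤ × ℤ × ℤ :=
  (k * r + q * z.1, k * r ^ 2 + 2 * r * q * z.1 + q ^ 2 * z.2.1,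
    k * r ^ 3 + 3 * r ^ 2 * q * z.1 + 3 * r * q ^ 2 * z.2.1 + q ^ 3 * z.2.2)

lemma ps_affine {k : ℕ} (r q : ℤ) (t : Fin k → ℤ) :
    ps (fun i => r + q * t i) = aff k r q (ps t) := by
  have h2 : ∀ i, (r + q * t i) ^ 2 = r ^ 2 + 2 * r * q * t i + q ^ 2 * t i ^ 2 := fun i => by ring
  have h3 : ∀ i, (r + q * t i) ^ 3 =
      r ^ 3 + 3 * r ^ 2 * q * t i + 3 * r * q ^ 2 * t i ^ 2 + q ^ 3 * t i ^ 3 := fun i => by ring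
  simp only [ps_eq, aff, h2, h3, sum_add_distrib, ← mul_sum, sum_const, card_univ,
    Fintype.card_fin, nsmul_eq_mul]

lemma aff_injective {k : ℕ} {r q : ℤ} (hq : q ≠ 0) : Function.Injective (aff k r q) := by
  rintro ⟨x, y, z⟩ ⟨x', y', z'⟩ h
  simp only [aff, Prod.mk.injEq] at h
  obtain ⟨h1, h2, h3⟩ := h
  obtain rfl : x = x' := mul_left_cancel₀ hq (by linarith)
  obtain rfl : y = y' := mul_left_cancel₀ (pow_ne_zero 2 hq) (by linarith)
  obtain rfl : z = z' := mul_left_cancel₀ (pow_ne_zero 3 hq) (by linarith)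
  rfl

/-- The integers in `[1, X]` congruent to `r` modulo `q`. -/
noncomputable def res (X q : ℕ) (r : ℤ) : Finset ℤ := {n ∈ Icc (1 : ℤ) X | (q : ℤ) ∣ n - r}

lemma mem_res {X q : ℕ} {r n : ℤ} : n ∈ res X q r ↔ (1 ≤ n ∧ n ≤ X) ∧ (q : ℤ) ∣ n - r := by
  simp [res]

/-- The twelfth moment count for a set of integers. -/
def sixes (S : Finset ℤ) : ℕ := coinc (tup 6 S) ps (tup 6 S) ps

lemma inBox_ps_sub {k X : ℕ} {S : Finset ℤ} (hS : ∀ n ∈ S, 1 ≤ n ∧ n ≤ X) {t s : Fin k → ℤ}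
    (ht : t ∈ tup k S) (hs : s ∈ tup k S) : InBox (k * X ^ 3) (ps t - ps s) := by
  rw [mem_tup] at ht hs
  have key : ∀ e : ℕ, 1 ≤ e → e ≤ 3 → |∑ i, t i ^ e - ∑ i, s i ^ e| ≤ ((k * X ^ 3 : ℕ) : ℤ) := by
    intro e he1 he
    rw [← sum_sub_distrib]
    refine (abs_sum_le_sum_abs _ _).trans ?_
    have : ∀ i ∈ (univ : Finset (Fin k)), |t i ^ e - s i ^ e| ≤ (X : ℤ) ^ 3 := by
      intro i _
      obtain ⟨a1, a2⟩ := hS _ (ht i)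
      obtain ⟨b1, b2⟩ := hS _ (hs i)
      have hX : (1 : ℤ) ≤ X := a1.trans a2
      have hp : (X : ℤ) ^ e ≤ X ^ 3 := pow_le_pow_right₀ hX he
      have h1 := pow_le_pow_left₀ (by linarith) a2 e
      have h2 := pow_le_pow_left₀ (by linarith) b2 e
      have h3 : 0 ≤ t i ^ e := by positivity
      have h4 : 0 ≤ s i ^ e := by positivity
      exact abs_le.2 ⟨by linarith, by linarith⟩
    refine (sum_le_card_nsmul _ _ _ this).trans_eq ?_
    simp
  refine ⟨?_, ?_, ?_⟩ <;> simp only [ps_eq, Prod.fst_sub, Prod.snd_sub]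
  · simpa using key 1 le_rfl (by norm_num)
  · exact key 2 (by norm_num) (by norm_num)
  · exact key 3 (by norm_num) (by norm_num)

lemma InBox.mono {B B' : ℕ} (h : B ≤ B') {z : ℤ × ℤ × ℤ} (hz : InBox B z) : InBox B' z := by
  have h' : (B : ℤ) ≤ B' := by exact_mod_cast h
  exact ⟨hz.1.trans h', hz.2.1.trans h', hz.2.2.trans h'⟩

lemma mean_pow_twelve {X B : ℕ} (hB : 6 * X ^ 3 ≤ B) {S : Finset ℤ}
    (hS : ∀ n ∈ S, 1 ≤ n ∧ n ≤ X) :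
    mean (B := B) (fun ψ => ‖expSum S mom ψ‖ ^ 12) = sixes S := by
  rw [sixes, ← mean_norm_sq (B := B)]
  · congr 1
    funext ψ
    rw [expSum_tup, norm_pow]
    ring
  · intro t ht s hs
    exact (inBox_ps_sub hS ht hs).mono hB

lemma sixes_res_le (X : ℕ) {q : ℕ} (hq : 0 < q) (r : ℤ) :
    sixes (res X q r) ≤ sixes (Icc 1 ((X / q + 1 : ℕ) : ℤ)) := by
  have hq' : (0 : ℤ) < q := by exact_mod_cast hq
  set r₀ := r % q with hr₀
  have hr1 : 0 ≤ r₀ := Int.emod_nonneg _ hq'.ne'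
  have hr2 : r₀ < q := Int.emod_lt_of_pos _ hq'
  set g : ℤ → ℤ := fun n => (n - r₀) / q + 1 with hg
  have hgn : ∀ n ∈ res X q r, n = (r₀ - q) + q * g n := by
    intro n hn
    rw [mem_res] at hn
    have : (q : ℤ) ∣ n - r₀ := by
      have h1 : (q : ℤ) ∣ r - r₀ := by
        rw [hr₀]
        exact Int.dvd_self_sub_emod
      have := dvd_add hn.2 h1
      rwa [sub_add_sub_cancel] at this
    have h2 := Int.mul_ediv_cancel' this
    simp only [hg]
    linarith
  have hgm : ∀ n ∈ res X q r, g n ∈ Icc 1 ((X / q + 1 : ℕ) : ℤ) := by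
    intro n hn
    have h1 := hgn n hn
    rw [mem_res] at hn
    rw [mem_Icc]
    constructor
    · by_contra h
      have : (q : ℤ) * g n ≤ 0 := mul_nonpos_of_nonneg_of_nonpos hq'.le (by omega)
      linarith
    · push_cast
      simp only [hg]
      have := Int.ediv_le_ediv hq' (by linarith : n - r₀ ≤ X)
      linarith
  unfold sixes coinc
  refine card_le_card_of_injOn (fun z => (fun i => g (z.1 i), fun i => g (z.2 i)))
    (fun z hz => ?_) ?_
  · simp only [coe_filter, mem_product, Set.mem_ofPred_eq, mem_tup] at hz ⊢
    refine ⟨⟨fun i => hgm _ (hz.1.1 i), fun i => hgm _ (hz.1.2 i)⟩, ?_⟩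
    have e1 : z.1 = fun i => (r₀ - q) + q * g (z.1 i) := funext fun i => hgn _ (hz.1.1 i)
    have e2 : z.2 = fun i => (r₀ - q) + q * g (z.2 i) := funext fun i => hgn _ (hz.1.2 i)
    have h := hz.2
    rw [e1, e2, ps_affine, ps_affine] at h
    exact aff_injective hq'.ne' h
  · rintro ⟨x, y⟩ hz ⟨x', y'⟩ hz' h
    simp only [coe_filter, mem_product, Set.mem_ofPred_eq, mem_tup] at hz hz'
    simp only [Prod.mk.injEq, funext_iff] at h
    refine Prod.ext (funext fun i => ?_) (funext fun i => ?_)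
    · exact (hgn _ (hz.1.1 i)).trans ((hgn _ (hz'.1.1 i)).trans (by rw [h.1 i])).symm
    · exact (hgn _ (hz.1.2 i)).trans ((hgn _ (hz'.1.2 i)).trans (by rw [h.2 i])).symm

/-- The absolute value of the exponential sum over a residue class. -/
noncomputable def resSum (X q : ℕ) (r : ℤ) (ψ : Dual (12 * X ^ 3)) : ℝ :=
  ‖expSum (res X q r) mom ψ‖

lemma resSum_nonneg (X q : ℕ) (r : ℤ) (ψ : Dual (12 * X ^ 3)) : 0 ≤ resSum X q r ψ := norm_nonneg _

lemma mean_resSum_pow_twelve_le (X : ℕ) {q : ℕ} (hq : 0 < q) (r : ℤ) :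
    mean (fun ψ => resSum X q r ψ ^ 12) ≤ sixes (Icc 1 ((X / q + 1 : ℕ) : ℤ)) := by
  unfold resSum
  rw [mean_pow_twelve (X := X) (by omega) fun n hn => (mem_res.1 hn).1]
  exact_mod_cast sixes_res_le X hq r

/-- The mixed moment with exponents `2 k` and `2 l`. -/
noncomputable def mix (k l X p a b : ℕ) (ξ η : ℤ) : ℝ :=
  mean fun ψ => resSum X (p ^ a) ξ ψ ^ (2 * k) * resSum X (p ^ b) η ψ ^ (2 * l)

lemma mix_nonneg (k l X p a b : ℕ) (ξ η : ℤ) : 0 ≤ mix k l X p a b ξ η :=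
  mean_nonneg fun _ => mul_nonneg (pow_nonneg (resSum_nonneg _ _ _ _) _)
    (pow_nonneg (resSum_nonneg _ _ _ _) _)

lemma expSum_mixed {B k l : ℕ} (S S' : Finset ℤ) (ψ : Dual B) :
    expSum (tup k S ×ˢ tup l S') (fun p => ps p.1 + ps p.2) ψ =
      expSum S mom ψ ^ k * expSum S' mom ψ ^ l := by
  rw [congrFun (expSum_product (tup k S) ps (tup l S') ps) ψ, expSum_tup, expSum_tup]

lemma mix_eq (k l X p a b : ℕ) (hkl : k + l ≤ 12) (ξ η : ℤ) :
    mix k l X p a b ξ η =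
      coinc (tup k (res X (p ^ a) ξ) ×ˢ tup l (res X (p ^ b) η)) (fun p => ps p.1 + ps p.2)
        (tup k (res X (p ^ a) ξ) ×ˢ tup l (res X (p ^ b) η)) (fun p => ps p.1 + ps p.2) := by
  rw [← mean_norm_sq (B := 12 * X ^ 3)]
  · unfold mix
    congr 1
    funext ψ
    rw [expSum_mixed, resSum, resSum, norm_mul, norm_pow, norm_pow]
    ring
  · rintro ⟨x, y⟩ h ⟨x', y'⟩ h'
    rw [mem_product] at h h'
    have h1 := inBox_ps_sub (fun n hn => (mem_res.1 hn).1) h.1 h'.1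
    have h2 := inBox_ps_sub (fun n hn => (mem_res.1 hn).1) h.2 h'.2
    have h3 : (k * X ^ 3 : ℕ) + (l * X ^ 3 : ℕ) ≤ 12 * X ^ 3 := by
      rw [← add_mul]
      gcongr
    zify at h3
    have e : ∀ u v u' v' : ℤ, u + v - (u' + v') = (u - u') + (v - v') := fun _ _ _ _ => by ring
    refine ⟨?_, ?_, ?_⟩ <;> simp only [Prod.fst_sub, Prod.snd_sub, Prod.fst_add, Prod.snd_add, e]
    · have := h1.1
      have := h2.1
      simp only [Prod.fst_sub] at *
      exact (abs_add_le _ _).trans (by push_cast at *; linarith)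
    · have := h1.2.1
      have := h2.2.1
      simp only [Prod.fst_sub, Prod.snd_sub] at *
      exact (abs_add_le _ _).trans (by push_cast at *; linarith)
    · have := h1.2.2
      have := h2.2.2
      simp only [Prod.snd_sub] at *
      exact (abs_add_le _ _).trans (by push_cast at *; linarith)

lemma rpow_mul_rpow_eq {x y θ : ℝ} (hx : 0 ≤ x) (hy : 0 ≤ y) (h0 : 0 < θ) (h1 : θ < 1)
    {i j i' j' m n : ℕ} (hm : i * θ + i' * (1 - θ) = m) (hn : j * θ + j' * (1 - θ) = n) :
    (x ^ i * y ^ j) ^ θ * (x ^ i' * y ^ j') ^ (1 - θ) = x ^ m * y ^ n := by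
  have key : ∀ {z : ℝ} {i i' m : ℕ}, 0 ≤ z → i * θ + i' * (1 - θ) = m →
      (z ^ i) ^ θ * (z ^ i') ^ (1 - θ) = z ^ m := by
    intro z i i' m hz hm
    rw [← Real.rpow_natCast z i, ← Real.rpow_natCast z i', ← Real.rpow_natCast z m,
      ← Real.rpow_mul hz, ← Real.rpow_mul hz, ← hm, Real.rpow_add_of_nonneg hz]
    · positivity
    · exact mul_nonneg (by positivity) (by linarith)
  rw [Real.mul_rpow (by positivity) (by positivity), Real.mul_rpow (by positivity) (by positivity),
    ← key hx hm, ← key hy hn]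
  ring

lemma mix_comm (k l X p a b : ℕ) (ξ η : ℤ) : mix k l X p a b ξ η = mix l k X p b a η ξ := by
  unfold mix
  simp_rw [mul_comm]

lemma mix_two_four_le_holder (X p a b : ℕ) (ξ η : ℤ) :
    mix 2 4 X p a b ξ η ≤
      mix 2 4 X p b a η ξ ^ (1 / 3 : ℝ) * mix 1 5 X p a b ξ η ^ (2 / 3 : ℝ) := by
  rw [mix_comm 2 4 X p b a η ξ]
  have h := mean_rpow_mul_rpow_le (B := 12 * X ^ 3) (θ := 1 / 3) (by norm_num) (by norm_num)
    (f := fun ψ => resSum X (p ^ a) ξ ψ ^ (2 * 4) * resSum X (p ^ b) η ψ ^ (2 * 2))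
    (g := fun ψ => resSum X (p ^ a) ξ ψ ^ (2 * 1) * resSum X (p ^ b) η ψ ^ (2 * 5))
    (fun ψ => mul_nonneg (pow_nonneg (resSum_nonneg _ _ _ _) _) (pow_nonneg (resSum_nonneg _ _ _ _) _))
    (fun ψ => mul_nonneg (pow_nonneg (resSum_nonneg _ _ _ _) _) (pow_nonneg (resSum_nonneg _ _ _ _) _))
  norm_num only at h
  unfold mix
  refine le_trans (le_of_eq ?_) h
  congr 1
  funext ψ
  have := rpow_mul_rpow_eq (θ := 1 / 3) (resSum_nonneg X (p ^ a) ξ ψ) (resSum_nonneg X (p ^ b) η ψ)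
    (by norm_num) (by norm_num) (i := 8) (j := 4) (i' := 2) (j' := 10) (m := 4) (n := 8)
    (by norm_num) (by norm_num)
  norm_num only at this ⊢
  exact this.symm

lemma mix_one_five_le_holder (X p a b : ℕ) (ξ η : ℤ) :
    mix 1 5 X p a b ξ η ≤ mix 2 4 X p b a η ξ ^ (1 / 4 : ℝ) *
      mean (fun ψ => resSum X (p ^ b) η ψ ^ 12) ^ (3 / 4 : ℝ) := by
  rw [mix_comm 2 4 X p b a η ξ]
  have h := mean_rpow_mul_rpow_le (B := 12 * X ^ 3) (θ := 1 / 4) (by norm_num) (by norm_num)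
    (f := fun ψ => resSum X (p ^ a) ξ ψ ^ (2 * 4) * resSum X (p ^ b) η ψ ^ (2 * 2))
    (g := fun ψ => resSum X (p ^ b) η ψ ^ 12)
    (fun ψ => mul_nonneg (pow_nonneg (resSum_nonneg _ _ _ _) _) (pow_nonneg (resSum_nonneg _ _ _ _) _))
    (fun ψ => pow_nonneg (resSum_nonneg _ _ _ _) _)
  norm_num only at h
  unfold mix
  refine le_trans (le_of_eq ?_) h
  congr 1
  funext ψ
  have := rpow_mul_rpow_eq (θ := 1 / 4) (resSum_nonneg X (p ^ a) ξ ψ) (resSum_nonneg X (p ^ b) η ψ)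
    (by norm_num) (by norm_num) (i := 8) (j := 4) (i' := 0) (j' := 12) (m := 2) (n := 10)
    (by norm_num) (by norm_num)
  rw [pow_zero, one_mul] at this
  norm_num only at this ⊢
  exact this.symm

lemma mix_two_four_le_sixes (X p a b : ℕ) (ξ η : ℤ) :
    mix 2 4 X p a b ξ η ≤ mean (fun ψ => resSum X (p ^ a) ξ ψ ^ 12) ^ (1 / 3 : ℝ) *
      mean (fun ψ => resSum X (p ^ b) η ψ ^ 12) ^ (2 / 3 : ℝ) := by
  have h := mean_rpow_mul_rpow_le (B := 12 * X ^ 3) (θ := 1 / 3) (by norm_num) (by norm_num)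
    (f := fun ψ => resSum X (p ^ a) ξ ψ ^ 12)
    (g := fun ψ => resSum X (p ^ b) η ψ ^ 12)
    (fun ψ => pow_nonneg (resSum_nonneg _ _ _ _) _)
    (fun ψ => pow_nonneg (resSum_nonneg _ _ _ _) _)
  norm_num only at h
  unfold mix
  refine le_trans (le_of_eq ?_) h
  congr 1
  funext ψ
  have := rpow_mul_rpow_eq (θ := 1 / 3) (resSum_nonneg X (p ^ a) ξ ψ) (resSum_nonneg X (p ^ b) η ψ)
    (by norm_num) (by norm_num) (i := 12) (j := 0) (i' := 0) (j' := 12) (m := 4) (n := 8)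
    (by norm_num) (by norm_num)
  rw [pow_zero, pow_zero, one_mul, mul_one] at this
  norm_num only at this ⊢
  exact this.symm

lemma ps_dvd {k : ℕ} {q : ℤ} {t : Fin k → ℤ} (h : ∀ i, q ∣ t i) :
    q ∣ (ps t).1 ∧ q ^ 2 ∣ (ps t).2.1 ∧ q ^ 3 ∣ (ps t).2.2 := by
  simp only [ps_eq]
  exact ⟨dvd_sum fun i _ => h i, dvd_sum fun i _ => pow_dvd_pow_of_dvd (h i) 2,
    dvd_sum fun i _ => pow_dvd_pow_of_dvd (h i) 3⟩

/-- After translating the variables in the second block to multiples of `q`, the remaining power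
sums are congruent. -/
lemma dvd_ps_sub {k l X q : ℕ} {η : ℤ} {x x' : Fin k → ℤ} {y y' : Fin l → ℤ}
    (hy : y ∈ tup l (res X q η)) (hy' : y' ∈ tup l (res X q η)) (h : ps x + ps y = ps x' + ps y') :
    (q : ℤ) ^ 2 ∣ ∑ i, (x i - η) ^ 2 - ∑ i, (x' i - η) ^ 2 ∧
      (q : ℤ) ^ 3 ∣ ∑ i, (x i - η) ^ 3 - ∑ i, (x' i - η) ^ 3 := by
  rw [mem_tup] at hy hy'
  have d := ps_dvd (t := fun i => y i - η) fun i => (mem_res.1 (hy i)).2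
  have d' := ps_dvd (t := fun i => y' i - η) fun i => (mem_res.1 (hy' i)).2
  have shift : ∀ {k : ℕ} (t : Fin k → ℤ), ps (fun i => t i - η) = aff k (-η) 1 (ps t) := by
    intro k t
    rw [← ps_affine]
    congr 1
    funext i
    ring
  have e : ps (fun i => x i - η) + ps (fun i => y i - η) =
      ps (fun i => x' i - η) + ps (fun i => y' i - η) := by
    simp only [shift]
    rw [Prod.ext_iff, Prod.ext_iff] at h ⊢
    simp only [aff, Prod.fst_add, Prod.snd_add] at h ⊢
    obtain ⟨h1, h2, h3⟩ := h
    refine ⟨by linarith, by linear_combination h2 - 2 * η * h1, ?_⟩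
    linear_combination h3 - 3 * η * h2 + 3 * η ^ 2 * h1
  rw [Prod.ext_iff, Prod.ext_iff] at e
  simp only [Prod.fst_add, Prod.snd_add] at e
  obtain ⟨-, e2, e3⟩ := e
  have c2 := dvd_sub d'.2.1 d.2.1
  have c3 := dvd_sub d'.2.2 d.2.2
  rw [show (ps fun i => y' i - η).2.1 - (ps fun i => y i - η).2.1 =
    (ps fun i => x i - η).2.1 - (ps fun i => x' i - η).2.1 by linarith] at c2
  rw [show (ps fun i => y' i - η).2.2 - (ps fun i => y i - η).2.2 =
    (ps fun i => x i - η).2.2 - (ps fun i => x' i - η).2.2 by linarith] at c3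
  simp only [ps_eq] at c2 c3
  exact ⟨c2, c3⟩

lemma dvd_sub_val {q : ℕ} [NeZero q] (w : ℤ) : (q : ℤ) ∣ w - ((w : ZMod q).val : ℤ) := by
  rw [← ZMod.intCast_zmod_eq_zero_iff_dvd]
  push_cast
  rw [ZMod.natCast_zmod_val, sub_self]

lemma mem_res_refine {X p a e : ℕ} {ξ x : ℤ} [NeZero (p ^ e)] (hx : x ∈ res X (p ^ a) ξ) {w : ℤ}
    (hw : x - ξ = (p ^ a : ℕ) * w) :
    x ∈ res X (p ^ (a + e)) (ξ + (p ^ a : ℕ) * ((w : ZMod (p ^ e)).val : ℤ)) := by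
  rw [mem_res] at hx ⊢
  refine ⟨hx.1, ?_⟩
  obtain ⟨c, hc⟩ := dvd_sub_val (q := p ^ e) w
  refine ⟨c, ?_⟩
  rw [pow_add]
  push_cast at hc hw ⊢
  linear_combination hw + (p : ℤ) ^ a * hc

lemma dvd_sub_of_dvd_cube_sub {p m : ℕ} (hp : p.Prime) (h5 : 5 ≤ p) {u v ζ : ℤ}
    (hu : (p : ℤ) ∣ u - ζ) (hv : (p : ℤ) ∣ v - ζ) (hζ : ¬ (p : ℤ) ∣ ζ)
    (h : (p : ℤ) ^ m ∣ u ^ 3 - v ^ 3) : (p : ℤ) ^ m ∣ u - v := by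
  have hpZ : Prime (p : ℤ) := Nat.prime_iff_prime_int.1 hp
  have hcop : IsCoprime ((p : ℤ) ^ m) (u ^ 2 + u * v + v ^ 2) := by
    refine IsCoprime.pow_left ((Prime.coprime_iff_not_dvd hpZ).2 fun hd => ?_)
    have h3 : (p : ℤ) ∣ 3 * ζ ^ 2 := by
      have e : 3 * ζ ^ 2 = (u ^ 2 + u * v + v ^ 2) - (u - ζ) * (u + ζ + v) - (v - ζ) * (v + 2 * ζ) := by
        ring
      rw [e]
      exact dvd_sub (dvd_sub hd (hu.mul_right _)) (hv.mul_right _)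
    rcases hpZ.dvd_or_dvd h3 with h | h
    · have := Int.le_of_dvd (by norm_num) h
      omega
    · exact hζ (hpZ.dvd_of_dvd_pow h)
  refine hcop.dvd_of_dvd_mul_right ?_
  rwa [show (u - v) * (u ^ 2 + u * v + v ^ 2) = u ^ 3 - v ^ 3 by ring]

lemma mix_one_five_le {X p a b : ℕ} {ξ η : ℤ} {M : ℝ} (hp : p.Prime) (h5 : 5 ≤ p) (ha : 1 ≤ a)
    (hab : a ≤ 3 * b) (hξ : ¬ (p : ℤ) ∣ ξ - η)
    (hM : ∀ κ, ¬ (p : ℤ) ∣ κ - η → mix 1 5 X p (3 * b) b κ η ≤ M) :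
    mix 1 5 X p a b ξ η ≤ p ^ (3 * b - a) * M := by
  have hpa : (p : ℤ) ∣ ((p ^ a : ℕ) : ℤ) := by exact_mod_cast dvd_pow_self p (by omega)
  have : NeZero (p ^ (3 * b - a)) := ⟨pow_ne_zero _ hp.ne_zero⟩
  have hb3 : a + (3 * b - a) = 3 * b := by omega
  set K : ZMod (p ^ (3 * b - a)) → ℤ := fun j => ξ + (p ^ a : ℕ) * (j.val : ℤ) with hK
  have hKη : ∀ j, ¬ (p : ℤ) ∣ K j - η := by
    intro j h
    apply hξ
    have := dvd_sub h (hpa.mul_right (j.val : ℤ))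
    rwa [hK, show ξ + (p ^ a : ℕ) * (j.val : ℤ) - η - (p ^ a : ℕ) * (j.val : ℤ) = ξ - η by ring]
      at this
  have key : ∀ t ∈ tup 1 (res X (p ^ a) ξ) ×ˢ tup 5 (res X (p ^ b) η),
      ∀ s ∈ tup 1 (res X (p ^ a) ξ) ×ˢ tup 5 (res X (p ^ b) η),
      ps t.1 + ps t.2 = ps s.1 + ps s.2 → ∃ j ∈ (univ : Finset (ZMod (p ^ (3 * b - a)))),
        t ∈ tup 1 (res X (p ^ (3 * b)) (K j)) ×ˢ tup 5 (res X (p ^ b) η) ∧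
        s ∈ tup 1 (res X (p ^ (3 * b)) (K j)) ×ˢ tup 5 (res X (p ^ b) η) := by
    rintro ⟨x, y⟩ ht ⟨x', y'⟩ hs h
    rw [mem_product] at ht hs
    obtain ⟨hx, hy⟩ := ht
    obtain ⟨hx', hy'⟩ := hs
    have hd := (dvd_ps_sub hy hy' h).2
    simp only [univ_unique, Fin.default_eq_zero, Fin.isValue, sum_singleton] at hd
    have m0 := mem_tup.1 hx 0
    have m0' := mem_tup.1 hx' 0
    have hsub : ((p ^ (3 * b) : ℕ) : ℤ) ∣ x 0 - x' 0 := by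
      have := dvd_sub_of_dvd_cube_sub (ζ := ξ - η) (m := 3 * b) hp h5 (u := x 0 - η) (v := x' 0 - η)
        ?_ ?_ hξ ?_
      · simpa using this
      · simpa using hpa.trans (mem_res.1 m0).2
      · simpa using hpa.trans (mem_res.1 m0').2
      · push_cast at hd
        rwa [← pow_mul, mul_comm b 3] at hd
    obtain ⟨w, hw⟩ := (mem_res.1 m0).2
    have r0 := mem_res_refine (e := 3 * b - a) m0 hw
    rw [hb3] at r0
    refine ⟨(w : ZMod _), mem_univ _, ?_, ?_⟩ <;> rw [mem_product, mem_tup]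
    · exact ⟨fun i => by rw [Subsingleton.elim i 0]; exact r0, hy⟩
    · refine ⟨fun i => ?_, hy'⟩
      rw [Subsingleton.elim i 0]
      simp only
      rw [mem_res] at r0 ⊢
      refine ⟨(mem_res.1 m0').1, ?_⟩
      have := dvd_sub r0.2 hsub
      rwa [show x 0 - (ξ + (p ^ a : ℕ) * ((w : ZMod (p ^ (3 * b - a))).val : ℤ)) - (x 0 - x' 0) =
        x' 0 - (ξ + (p ^ a : ℕ) * ((w : ZMod (p ^ (3 * b - a))).val : ℤ)) by ring] at this
  rw [mix_eq _ _ _ _ _ _ (by norm_num)]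
  have h1 := coinc_le_sum univ (fun j => tup 1 (res X (p ^ (3 * b)) (K j)) ×ˢ tup 5 (res X (p ^ b) η))
    (fun j => tup 1 (res X (p ^ (3 * b)) (K j)) ×ˢ tup 5 (res X (p ^ b) η)) key
  have h2 : ∀ j ∈ (univ : Finset (ZMod (p ^ (3 * b - a)))),
      ((coinc (tup 1 (res X (p ^ (3 * b)) (K j)) ×ˢ tup 5 (res X (p ^ b) η))
        (fun p => ps p.1 + ps p.2) (tup 1 (res X (p ^ (3 * b)) (K j)) ×ˢ tup 5 (res X (p ^ b) η))
        (fun p => ps p.1 + ps p.2) : ℕ) : ℝ) ≤ M := by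
    intro j _
    rw [← mix_eq _ _ _ _ _ _ (by norm_num)]
    exact hM _ (hKη j)
  refine (Nat.cast_le.2 h1).trans ?_
  rw [Nat.cast_sum]
  refine (sum_le_card_nsmul _ _ _ h2).trans_eq ?_
  rw [card_univ, ZMod.card, nsmul_eq_mul]
  push_cast
  rfl

lemma card_range_filter_dvd {d m : ℕ} (hd : 0 < d) : #{x ∈ range (d * m) | d ∣ x} = m := by
  have : {x ∈ range (d * m) | d ∣ x} = (range m).image (d * ·) := by
    ext x
    simp only [mem_filter, mem_range, mem_image]
    constructor
    · rintro ⟨h, c, rfl⟩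
      exact ⟨c, lt_of_mul_lt_mul_left h (Nat.zero_le _), rfl⟩
    · rintro ⟨c, hc, rfl⟩
      exact ⟨Nat.mul_lt_mul_of_pos_left hc hd, Dvd.intro _ rfl⟩
  rw [this, card_image_of_injective _ (mul_right_injective₀ hd.ne'), card_range]

/-- The number of zero products modulo a prime power. -/
lemma card_mul_eq_zero_le {p : ℕ} (hp : p.Prime) (e : ℕ) [NeZero (p ^ e)] :
    #{z : ZMod (p ^ e) × ZMod (p ^ e) | z.1 * z.2 = 0} ≤ (e + 1) * p ^ e := by
  set U : ℕ → Finset (ℕ × ℕ) := fun i =>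
    {x ∈ range (p ^ e) | p ^ i ∣ x} ×ˢ {x ∈ range (p ^ e) | p ^ (e - i) ∣ x} with hU
  have hUc : ∀ i ∈ range (e + 1), #(U i) ≤ p ^ e := by
    intro i hi
    have hi' : i ≤ e := Nat.lt_succ_iff.1 (mem_range.1 hi)
    have e1 : p ^ e = p ^ i * p ^ (e - i) := by rw [← pow_add]; congr 1; omega
    rw [hU]
    simp only [card_product]
    have c1 : #{x ∈ range (p ^ e) | p ^ i ∣ x} = p ^ (e - i) := by
      rw [e1]
      exact card_range_filter_dvd (pow_pos hp.pos _)
    have c2 : #{x ∈ range (p ^ e) | p ^ (e - i) ∣ x} = p ^ i := by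
      rw [e1, mul_comm]
      exact card_range_filter_dvd (pow_pos hp.pos _)
    rw [c1, c2, mul_comm, ← e1]
  have h1 : #{z : ZMod (p ^ e) × ZMod (p ^ e) | z.1 * z.2 = 0} ≤ #((range (e + 1)).biUnion U) := by
    refine card_le_card_of_injOn (fun z => (z.1.val, z.2.val)) (fun z hz => ?_) ?_
    · simp only [coe_filter, mem_univ, true_and, Set.mem_ofPred_eq] at hz
      have hd : p ^ e ∣ z.1.val * z.2.val := by
        rw [← ZMod.natCast_eq_zero_iff]
        push_cast
        simpa using hz
      obtain ⟨d₁, d₂, h1, h2, h3⟩ := exists_dvd_and_dvd_of_dvd_mul hd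
      obtain ⟨i, hi, rfl⟩ := (Nat.dvd_prime_pow hp).1 (Dvd.intro _ h3.symm)
      have hd2 : d₂ = p ^ (e - i) := by
        have e1 : p ^ e = p ^ i * p ^ (e - i) := by rw [← pow_add]; congr 1; omega
        exact Nat.eq_of_mul_eq_mul_left (pow_pos hp.pos i) (h3.symm.trans e1)
      rw [hd2] at h2
      simp only [coe_biUnion, Set.mem_iUnion, hU, coe_product, Set.mem_prod, mem_coe, mem_filter,
        mem_range]
      exact ⟨i, by omega, ⟨ZMod.val_lt _, h1⟩, ZMod.val_lt _, h2⟩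
    · rintro ⟨x, y⟩ _ ⟨x', y'⟩ _ h
      simp only [Prod.mk.injEq] at h
      rw [ZMod.val_injective _ h.1, ZMod.val_injective _ h.2]
  refine h1.trans (card_biUnion_le.trans ((sum_le_card_nsmul _ _ _ hUc).trans_eq ?_))
  rw [card_range, smul_eq_mul]

/-- The admissible residue classes in the congruence step. -/
def classes (q : ℕ) [NeZero q] (π ζ : ZMod q) : Finset ((Fin 2 → ZMod q) × (Fin 2 → ZMod q)) :=
  {κ | (κ.1 0 - κ.2 0) * (κ.1 0 + κ.2 0 - κ.1 1 - κ.2 1) = 0 ∧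
    (κ.1 0 - κ.2 0) * (2 * ζ + π * (κ.1 0 + κ.2 0)) =
      (κ.2 1 - κ.1 1) * (2 * ζ + π * (κ.1 1 + κ.2 1))}

lemma card_classes_le {p : ℕ} (hp : p.Prime) (e : ℕ) [NeZero (p ^ e)] {π ζ : ZMod (p ^ e)}
    (h2 : IsUnit (2 : ZMod (p ^ e))) (hu : ∀ w : ZMod (p ^ e), IsUnit (2 * ζ + π * w)) :
    #(classes (p ^ e) π ζ) ≤ (e + 1) * p ^ e * p ^ e := by
  have h1 : #(classes (p ^ e) π ζ) ≤ #(({z | z.1 * z.2 = 0} : Finset (ZMod (p ^ e) × ZMod (p ^ e))) ×ˢ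
      (univ : Finset (ZMod (p ^ e)))) := by
    refine card_le_card_of_injOn
      (fun κ => ((κ.1 0 - κ.2 0, κ.1 0 + κ.2 0 - κ.1 1 - κ.2 1), κ.1 0)) (fun κ hκ => ?_) ?_
    · simp only [classes, coe_filter, mem_univ, true_and, Set.mem_ofPred_eq, coe_product,
        Set.mem_prod, mem_coe] at hκ ⊢
      simpa using hκ.1
    · rintro ⟨x, y⟩ hκ ⟨x', y'⟩ hκ' h
      simp only [classes, coe_filter, mem_univ, true_and, Set.mem_ofPred_eq] at hκ hκ'
      simp only [Prod.mk.injEq] at h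
      obtain ⟨⟨e1, e2⟩, e3⟩ := h
      have e4 : y 0 = y' 0 := by linear_combination e3 - e1
      have e5 : x 1 + y 1 = x' 1 + y' 1 := by linear_combination e3 + e4 - e2
      have e6 : y 1 - x 1 = y' 1 - x' 1 := by
        refine (hu (x 1 + y 1)).mul_right_cancel ?_
        rw [← hκ.2, e5, ← hκ'.2, e3, e4]
      have e7 : x 1 = x' 1 := by
        refine h2.mul_left_cancel ?_
        linear_combination e5 - e6
      have e8 : y 1 = y' 1 := by linear_combination e5 - e7
      refine Prod.ext (funext fun i => ?_) (funext fun i => ?_) <;> fin_cases i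
      · exact e3
      · exact e7
      · exact e4
      · exact e8
  refine h1.trans ?_
  rw [card_product, card_univ, ZMod.card]
  gcongr
  exact card_mul_eq_zero_le hp e

lemma dvd_mul_sub_mul {P D D' s s' : ℤ} (h1 : P ∣ D * s - D' * s')
    (h2 : P ∣ D * (3 * s ^ 2 + D ^ 2) - D' * (3 * s' ^ 2 + D' ^ 2)) :
    P ∣ (3 * s * s' ^ 3 - D ^ 2 * (s ^ 2 + s * s' + s' ^ 2)) * (D * (s - s')) := by
  have e : (3 * s * s' ^ 3 - D ^ 2 * (s ^ 2 + s * s' + s' ^ 2)) * (D * (s - s')) =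
      s' ^ 3 * (D * (3 * s ^ 2 + D ^ 2) - D' * (3 * s' ^ 2 + D' ^ 2)) -
        (D * s - D' * s') * (3 * s' ^ 4 + ((D * s) ^ 2 + D * s * (D' * s') + (D' * s') ^ 2)) := by
    ring
  rw [e]
  exact dvd_sub (h2.mul_left _) (h1.mul_right _)

lemma mem_classes_of_dvd {p a b : ℕ} (hp : p.Prime) (h5 : 5 ≤ p) (ha : 1 ≤ a) (hab : a ≤ b)
    [NeZero (p ^ (2 * (b - a)))] {ζ : ℤ} (hζ : ¬ (p : ℤ) ∣ ζ) {w w' u u' : Fin 2 → ℤ}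
    (hu : ∀ i, u i = ζ + (p : ℤ) ^ a * w i) (hu' : ∀ i, u' i = ζ + (p : ℤ) ^ a * w' i)
    (h2 : (p : ℤ) ^ (2 * b) ∣ ∑ i, u i ^ 2 - ∑ i, u' i ^ 2)
    (h3 : (p : ℤ) ^ (2 * b) ∣ ∑ i, u i ^ 3 - ∑ i, u' i ^ 3) :
    ((fun i => (w i : ZMod (p ^ (2 * (b - a))))), fun i => (w' i : ZMod (p ^ (2 * (b - a))))) ∈
      classes (p ^ (2 * (b - a))) ((p : ZMod (p ^ (2 * (b - a)))) ^ a) (ζ : ZMod (p ^ (2 * (b - a)))) := by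
  have hpZ : Prime (p : ℤ) := Nat.prime_iff_prime_int.1 hp
  have hp0 : (p : ℤ) ≠ 0 := hpZ.ne_zero
  simp only [Fin.sum_univ_two] at h2 h3
  set D := u 0 - u' 0 with hD
  set D' := u' 1 - u 1 with hD'
  set s := u 0 + u' 0 with hs
  set s' := u 1 + u' 1 with hs'
  have c1 : (p : ℤ) ^ (2 * b) ∣ D * s - D' * s' := by
    rw [show D * s - D' * s' = u 0 ^ 2 + u 1 ^ 2 - (u' 0 ^ 2 + u' 1 ^ 2) by
      rw [hD, hD', hs, hs']; ring]
    exact h2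
  have c2 : (p : ℤ) ^ (2 * b) ∣ D * (3 * s ^ 2 + D ^ 2) - D' * (3 * s' ^ 2 + D' ^ 2) := by
    rw [show D * (3 * s ^ 2 + D ^ 2) - D' * (3 * s' ^ 2 + D' ^ 2) =
      4 * (u 0 ^ 3 + u 1 ^ 3 - (u' 0 ^ 3 + u' 1 ^ 3)) by rw [hD, hD', hs, hs']; ring]
    exact h3.mul_left _
  have hpa : (p : ℤ) ∣ (p : ℤ) ^ a := dvd_pow_self _ (by omega)
  have not_dvd : ∀ k : ℤ, 0 < k → k < p → ∀ z y : ℤ, z = k * ζ + (p : ℤ) ^ a * y → ¬ (p : ℤ) ∣ z := by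
    intro k hk hkp z y hz hd
    have : (p : ℤ) ∣ k * ζ := by
      have := dvd_sub hd (hpa.mul_right y)
      rwa [hz, add_sub_cancel_right] at this
    rcases hpZ.dvd_or_dvd this with h | h
    · exact absurd (Int.le_of_dvd hk h) (by omega)
    · exact hζ h
  have eD : D = (p : ℤ) ^ a * (w 0 - w' 0) := by rw [hD, hu, hu']; ring
  have eD' : D' = (p : ℤ) ^ a * (w' 1 - w 1) := by rw [hD', hu, hu']; ring
  have es : s = 2 * ζ + (p : ℤ) ^ a * (w 0 + w' 0) := by rw [hs, hu, hu']; ring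
  have es' : s' = 2 * ζ + (p : ℤ) ^ a * (w 1 + w' 1) := by rw [hs', hu, hu']; ring
  have hcop : IsCoprime ((p : ℤ) ^ (2 * b))
      (3 * s * s' ^ 3 - D ^ 2 * (s ^ 2 + s * s' + s' ^ 2)) := by
    refine IsCoprime.pow_left ((Prime.coprime_iff_not_dvd hpZ).2 fun hd => ?_)
    have hpD : (p : ℤ) ∣ D := eD ▸ hpa.mul_right _
    have h := dvd_add hd ((hpD.pow (by norm_num : 2 ≠ 0)).mul_right (s ^ 2 + s * s' + s' ^ 2))
    rw [sub_add_cancel] at h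
    rcases hpZ.dvd_or_dvd h with h | h
    · rcases hpZ.dvd_or_dvd h with h | h
      · exact absurd (Int.le_of_dvd (by norm_num) h) (by omega)
      · exact not_dvd 2 (by norm_num) (by omega) _ _ es h
    · exact not_dvd 2 (by norm_num) (by omega) _ _ es' (hpZ.dvd_of_dvd_pow h)
  have c3 := hcop.dvd_of_dvd_mul_left (dvd_mul_sub_mul c1 c2)
  have hpow : (p : ℤ) ^ (2 * b) = (p : ℤ) ^ a * (p : ℤ) ^ a * (p : ℤ) ^ (2 * (b - a)) := by
    rw [← pow_add, ← pow_add]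
    congr 1
    omega
  have r1 : (p : ℤ) ^ (2 * (b - a)) ∣ (w 0 - w' 0) * (w 0 + w' 0 - w 1 - w' 1) := by
    rw [hpow, eD, es, es', show (p : ℤ) ^ a * (w 0 - w' 0) * (2 * ζ + (p : ℤ) ^ a * (w 0 + w' 0) -
      (2 * ζ + (p : ℤ) ^ a * (w 1 + w' 1))) = (p : ℤ) ^ a * (p : ℤ) ^ a *
        ((w 0 - w' 0) * (w 0 + w' 0 - w 1 - w' 1)) by ring] at c3
    exact Int.dvd_of_mul_dvd_mul_left (by positivity) c3
  have r2 : (p : ℤ) ^ (2 * (b - a)) ∣ (w 0 - w' 0) * (2 * ζ + (p : ℤ) ^ a * (w 0 + w' 0)) -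
      (w' 1 - w 1) * (2 * ζ + (p : ℤ) ^ a * (w 1 + w' 1)) := by
    have h := c1
    rw [← es, ← es']
    rw [hpow, eD, eD', show (p : ℤ) ^ a * (w 0 - w' 0) * s - (p : ℤ) ^ a * (w' 1 - w 1) * s' =
      (p : ℤ) ^ a * ((w 0 - w' 0) * s - (w' 1 - w 1) * s') by ring, mul_assoc] at h
    exact dvd_of_mul_left_dvd (Int.dvd_of_mul_dvd_mul_left (by positivity) h)
  have cast : ∀ z : ℤ, (p : ℤ) ^ (2 * (b - a)) ∣ z → (z : ZMod (p ^ (2 * (b - a)))) = 0 := by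
    intro z hz
    rw [ZMod.intCast_zmod_eq_zero_iff_dvd]
    exact_mod_cast hz
  have q1 := cast _ r1
  have q2 := cast _ r2
  push_cast at q1 q2
  simp only [classes, mem_filter, mem_univ, true_and]
  exact ⟨q1, sub_eq_zero.1 q2⟩

/-- Pairs whose entries lie in prescribed residue classes. -/
noncomputable def resPairs (X q : ℕ) (κ : Fin 2 → ℤ) : Finset (Fin 2 → ℤ) :=
  Fintype.piFinset fun i => res X q (κ i)

lemma norm_expSum_resPairs {X : ℕ} (q : ℕ) (κ : Fin 2 → ℤ) (ψ : Dual (12 * X ^ 3)) :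
    ‖expSum (resPairs X q κ) ps ψ‖ = resSum X q (κ 0) ψ * resSum X q (κ 1) ψ := by
  unfold resSum expSum ps resPairs
  simp_rw [ev_sum]
  have h := Finset.prod_univ_sum (fun i : Fin 2 => res X q (κ i)) (fun _ n => ev ψ (mom n))
  rw [← h, Fin.prod_univ_two, norm_mul]

lemma mul_mul_mul_le_pow_four {w x y z : ℝ} :
    w * x * (y * z) ≤ 1 / 4 * (w ^ 4 + x ^ 4 + y ^ 4 + z ^ 4) := by
  nlinarith [sq_nonneg (w * x - y * z), sq_nonneg (w ^ 2 - x ^ 2), sq_nonneg (y ^ 2 - z ^ 2)]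

lemma coinc_resPairs_le {X p c b : ℕ} {η : ℤ} {M : ℝ} {κ κ' : Fin 2 → ℤ}
    (hκ : ∀ i, mix 2 4 X p c b (κ i) η ≤ M) (hκ' : ∀ i, mix 2 4 X p c b (κ' i) η ≤ M) :
    (coinc (resPairs X (p ^ c) κ ×ˢ tup 4 (res X (p ^ b) η)) (fun p => ps p.1 + ps p.2)
      (resPairs X (p ^ c) κ' ×ˢ tup 4 (res X (p ^ b) η)) (fun p => ps p.1 + ps p.2) : ℝ) ≤ M := by
  refine (coinc_le_mean (B := 12 * X ^ 3) _ _ _ _).trans ?_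
  have key : ∀ ψ : Dual (12 * X ^ 3),
      ‖expSum (resPairs X (p ^ c) κ ×ˢ tup 4 (res X (p ^ b) η)) (fun p => ps p.1 + ps p.2) ψ‖ *
        ‖expSum (resPairs X (p ^ c) κ' ×ˢ tup 4 (res X (p ^ b) η)) (fun p => ps p.1 + ps p.2) ψ‖ ≤
      1 / 4 * (resSum X (p ^ c) (κ 0) ψ ^ (2 * 2) * resSum X (p ^ b) η ψ ^ (2 * 4) +
        resSum X (p ^ c) (κ 1) ψ ^ (2 * 2) * resSum X (p ^ b) η ψ ^ (2 * 4) +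
        resSum X (p ^ c) (κ' 0) ψ ^ (2 * 2) * resSum X (p ^ b) η ψ ^ (2 * 4) +
        resSum X (p ^ c) (κ' 1) ψ ^ (2 * 2) * resSum X (p ^ b) η ψ ^ (2 * 4)) := by
    intro ψ
    have e := expSum_tup 4 (res X (p ^ b) η) ψ
    rw [congrFun (expSum_product _ _ _ _) ψ, congrFun (expSum_product _ _ _ _) ψ, norm_mul,
      norm_mul, norm_expSum_resPairs, norm_expSum_resPairs, e, norm_pow,
      show ‖expSum (res X (p ^ b) η) mom ψ‖ = resSum X (p ^ b) η ψ from rfl]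
    have h := mul_le_mul_of_nonneg_right (mul_mul_mul_le_pow_four (w := resSum X (p ^ c) (κ 0) ψ)
      (x := resSum X (p ^ c) (κ 1) ψ) (y := resSum X (p ^ c) (κ' 0) ψ)
      (z := resSum X (p ^ c) (κ' 1) ψ)) (pow_nonneg (resSum_nonneg X (p ^ b) η ψ) 8)
    linarith
  refine (mean_mono key).trans ?_
  rw [mean_const_mul, mean_add, mean_add, mean_add]
  have h0 := hκ 0
  have h1 := hκ 1
  have h2 := hκ' 0
  have h3 := hκ' 1
  unfold mix at h0 h1 h2 h3
  linarith

lemma isUnit_intCast_zmod {p : ℕ} (hp : p.Prime) (e : ℕ) {z : ℤ} (hz : ¬ (p : ℤ) ∣ z) :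
    IsUnit (z : ZMod (p ^ e)) := by
  rw [ZMod.coe_int_isUnit_iff_isCoprime]
  push_cast
  exact IsCoprime.pow_left ((Prime.coprime_iff_not_dvd (Nat.prime_iff_prime_int.1 hp)).2 hz)

lemma mix_two_four_le {X p a b : ℕ} {ξ η : ℤ} {M : ℝ} (hp : p.Prime) (h5 : 5 ≤ p) (ha : 1 ≤ a)
    (hab : a ≤ b) (hξ : ¬ (p : ℤ) ∣ ξ - η)
    (hM : ∀ κ, ¬ (p : ℤ) ∣ κ - η → mix 2 4 X p (a + 2 * (b - a)) b κ η ≤ M) :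
    mix 2 4 X p a b ξ η ≤ (2 * (b - a) + 1 : ℕ) * p ^ (4 * (b - a)) * M := by
  have hpZ : Prime (p : ℤ) := Nat.prime_iff_prime_int.1 hp
  have hpa : (p : ℤ) ∣ ((p ^ a : ℕ) : ℤ) := by exact_mod_cast dvd_pow_self p (by omega)
  have : NeZero (p ^ (2 * (b - a))) := ⟨pow_ne_zero _ hp.ne_zero⟩
  set e := 2 * (b - a) with he
  set K : (Fin 2 → ZMod (p ^ e)) → Fin 2 → ℤ := fun w i => ξ + (p ^ a : ℕ) * ((w i).val : ℤ) with hK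
  have hKη : ∀ w i, ¬ (p : ℤ) ∣ K w i - η := by
    intro w i h
    apply hξ
    have := dvd_sub h (hpa.mul_right ((w i).val : ℤ))
    rwa [hK, show ξ + (p ^ a : ℕ) * ((w i).val : ℤ) - η - (p ^ a : ℕ) * ((w i).val : ℤ) = ξ - η by
      ring] at this
  have hM0 : 0 ≤ M := (mix_nonneg _ _ _ _ _ _ _ _).trans (hM ξ hξ)
  set A := classes (p ^ e) ((p : ZMod (p ^ e)) ^ a) ((ξ - η : ℤ) : ZMod (p ^ e)) with hA
  set Y := tup 4 (res X (p ^ b) η) with hY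
  have key : ∀ t ∈ tup 2 (res X (p ^ a) ξ) ×ˢ Y, ∀ s ∈ tup 2 (res X (p ^ a) ξ) ×ˢ Y,
      ps t.1 + ps t.2 = ps s.1 + ps s.2 → ∃ j ∈ A,
        t ∈ resPairs X (p ^ (a + e)) (K j.1) ×ˢ Y ∧ s ∈ resPairs X (p ^ (a + e)) (K j.2) ×ˢ Y := by
    rintro ⟨x, y⟩ ht ⟨x', y'⟩ hs h
    rw [mem_product] at ht hs
    obtain ⟨hx, hy⟩ := ht
    obtain ⟨hx', hy'⟩ := hs
    obtain ⟨d2, d3⟩ := dvd_ps_sub hy hy' h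
    have hx1 := mem_tup.1 hx
    have hx1' := mem_tup.1 hx'
    choose w hw using fun i => (mem_res.1 (hx1 i)).2
    choose w' hw' using fun i => (mem_res.1 (hx1' i)).2
    refine ⟨(fun i => (w i : ZMod _), fun i => (w' i : ZMod _)), ?_, ?_, ?_⟩
    · refine mem_classes_of_dvd hp h5 ha hab hξ (u := fun i => x i - η) (u' := fun i => x' i - η)
        (fun i => ?_) (fun i => ?_) ?_ ?_
      · have := hw i
        push_cast at this
        linarith
      · have := hw' i
        push_cast at this
        linarith
      · push_cast at d2
        rwa [← pow_mul, mul_comm b 2] at d2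
      · push_cast at d3
        rw [← pow_mul] at d3
        exact (pow_dvd_pow _ (by omega)).trans d3
    · rw [mem_product, resPairs, Fintype.mem_piFinset]
      exact ⟨fun i => mem_res_refine (hx1 i) (hw i), hy⟩
    · rw [mem_product, resPairs, Fintype.mem_piFinset]
      exact ⟨fun i => mem_res_refine (hx1' i) (hw' i), hy'⟩
  rw [mix_eq _ _ _ _ _ _ (by norm_num)]
  have h1 := coinc_le_sum A _ _ key
  refine (Nat.cast_le.2 h1).trans ?_
  rw [Nat.cast_sum]
  refine (sum_le_card_nsmul _ _ M fun j _ => ?_).trans ?_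
  · exact coinc_resPairs_le (fun i => hM _ (hKη _ i)) (fun i => hM _ (hKη _ i))
  · rw [nsmul_eq_mul]
    refine mul_le_mul_of_nonneg_right ?_ hM0
    have hu2 : IsUnit (2 : ZMod (p ^ e)) := by
      have := isUnit_intCast_zmod hp e (z := 2) fun h => by
        have := Int.le_of_dvd (by norm_num) h
        omega
      exact_mod_cast this
    have hu : ∀ w, IsUnit (2 * ((ξ - η : ℤ) : ZMod (p ^ e)) + (p : ZMod (p ^ e)) ^ a * w) := by
      intro w
      have := isUnit_intCast_zmod hp e (z := 2 * (ξ - η) + (p : ℤ) ^ a * (w.val : ℤ)) fun h => by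
        have h := (dvd_add_left ((dvd_pow_self (p : ℤ) (by omega : a ≠ 0)).mul_right _)).1 h
        rcases hpZ.dvd_or_dvd h with h | h
        · have := Int.le_of_dvd (by norm_num) h
          omega
        · exact hξ h
      push_cast at this
      rw [ZMod.natCast_zmod_val] at this
      push_cast
      exact this
    have h := card_classes_le hp e hu2 hu
    have h' : ((#A : ℕ) : ℝ) ≤ ((e + 1) * p ^ e * p ^ e : ℕ) := Nat.cast_le.2 h
    refine h'.trans_eq ?_
    rw [show 4 * (b - a) = e + e by omega, pow_add]
    push_cast
    ring

lemma mean_resSum_le {C s : ℝ} (hC : 0 ≤ C) (hs : 0 ≤ s)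
    (h : ∀ N : ℕ, 1 ≤ N → (sixes (Icc 1 (N : ℤ)) : ℝ) ≤ C * (N : ℝ) ^ s) {X p b : ℕ} (hp : 0 < p)
    (hX : p ^ b ≤ X) (η : ℤ) :
    mean (fun ψ => resSum X (p ^ b) η ψ ^ 12) ≤
      C * 2 ^ s * ((X : ℝ) ^ s * (p : ℝ) ^ (-(b * s))) := by
  have hq : 0 < p ^ b := pow_pos hp b
  refine (mean_resSum_pow_twelve_le X hq η).trans ((h _ (Nat.succ_le_succ (Nat.zero_le _))).trans ?_)
  have hp' : (0 : ℝ) < p := by exact_mod_cast hp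
  have h1 : ((X / p ^ b + 1 : ℕ) : ℝ) ≤ 2 * (X / (p : ℝ) ^ b) := by
    have e1 : ((X / p ^ b : ℕ) : ℝ) ≤ X / (p : ℝ) ^ b := by
      refine Nat.cast_div_le.trans_eq ?_
      push_cast
      rfl
    have e2 : 1 ≤ X / (p : ℝ) ^ b := by
      rw [one_le_div (by positivity)]
      exact_mod_cast hX
    push_cast at e1 ⊢
    linarith
  have h2 : (2 * (X / (p : ℝ) ^ b)) ^ s = 2 ^ s * ((X : ℝ) ^ s * (p : ℝ) ^ (-(b * s))) := by
    rw [Real.mul_rpow (by norm_num) (by positivity), Real.div_rpow (by positivity) (by positivity),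
      ← Real.rpow_natCast, ← Real.rpow_mul hp'.le, Real.rpow_neg hp'.le, div_eq_mul_inv]
  rw [mul_assoc, ← h2]
  gcongr

lemma mix_two_four_step {X p a b : ℕ} {ξ η : ℤ} {M₁ M₂ J : ℝ} (hp : p.Prime) (h5 : 5 ≤ p)
    (ha : 1 ≤ a) (hab : a ≤ b) (hξ : ¬ (p : ℤ) ∣ ξ - η)
    (h₁ : ∀ κ, ¬ (p : ℤ) ∣ η - κ → mix 2 4 X p b (2 * b - a) η κ ≤ M₁)
    (h₂ : ∀ κ, ¬ (p : ℤ) ∣ η - κ → mix 2 4 X p b (3 * b) η κ ≤ M₂)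
    (hJ : mean (fun ψ => resSum X (p ^ b) η ψ ^ 12) ≤ J) :
    mix 2 4 X p a b ξ η ≤ (2 * (b - a) + 1 : ℕ) * p ^ (4 * (b - a)) *
      (M₁ ^ (1 / 3 : ℝ) * (p ^ (a + b) * (M₂ ^ (1 / 4 : ℝ) * J ^ (3 / 4 : ℝ))) ^ (2 / 3 : ℝ)) := by
  have hsymm : ∀ κ, ¬ (p : ℤ) ∣ κ - η → ¬ (p : ℤ) ∣ η - κ := fun κ h => by rwa [dvd_sub_comm]
  have h12 : 0 ≤ mean (fun ψ => resSum X (p ^ b) η ψ ^ 12) :=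
    mean_nonneg fun _ => pow_nonneg (resSum_nonneg _ _ _ _) _
  refine mix_two_four_le hp h5 ha hab hξ fun κ hκ => ?_
  rw [show a + 2 * (b - a) = 2 * b - a by omega]
  refine (mix_two_four_le_holder X p (2 * b - a) b κ η).trans ?_
  have h15 : mix 1 5 X p (2 * b - a) b κ η ≤
      p ^ (a + b) * (M₂ ^ (1 / 4 : ℝ) * J ^ (3 / 4 : ℝ)) := by
    rw [show a + b = 3 * b - (2 * b - a) by omega]
    refine mix_one_five_le hp h5 (by omega) (by omega) hκ fun κ' hκ' => ?_
    refine (mix_one_five_le_holder X p (3 * b) b κ' η).trans ?_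
    refine mul_le_mul ?_ ?_ (Real.rpow_nonneg h12 _) ?_
    · exact Real.rpow_le_rpow (mix_nonneg _ _ _ _ _ _ _ _) (h₂ _ (hsymm _ hκ')) (by norm_num)
    · exact Real.rpow_le_rpow h12 hJ (by norm_num)
    · exact Real.rpow_nonneg ((mix_nonneg _ _ _ _ _ _ _ _).trans (h₂ _ (hsymm _ hκ'))) _
  refine mul_le_mul ?_ ?_ (Real.rpow_nonneg (mix_nonneg _ _ _ _ _ _ _ _) _) ?_
  · exact Real.rpow_le_rpow (mix_nonneg _ _ _ _ _ _ _ _) (h₁ _ (hsymm _ hκ)) (by norm_num)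
  · exact Real.rpow_le_rpow (mix_nonneg _ _ _ _ _ _ _ _) h15 (by norm_num)
  · exact Real.rpow_nonneg ((mix_nonneg _ _ _ _ _ _ _ _).trans (h₁ _ (hsymm _ hκ))) _

lemma mul_mul_rpow_rpow {C Y P e θ : ℝ} (hC : 0 ≤ C) (hY : 0 < Y) (hP : 0 < P) :
    (C * (Y * P ^ e)) ^ θ = C ^ θ * (Y ^ θ * P ^ (e * θ)) := by
  rw [Real.mul_rpow hC (by positivity), Real.mul_rpow hY.le (by positivity), ← Real.rpow_mul hP.le]

lemma rpow_bookkeeping {C₁ C₂ C₃ Y P e₁ e₂ e₃ : ℝ} (k l : ℕ) (h₁ : 0 ≤ C₁) (h₂ : 0 ≤ C₂)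
    (h₃ : 0 ≤ C₃) (hY : 0 < Y) (hP : 0 < P) :
    P ^ k * ((C₁ * (Y * P ^ e₁)) ^ (1 / 3 : ℝ) * (P ^ l * ((C₂ * (Y * P ^ e₂)) ^ (1 / 4 : ℝ) *
      (C₃ * (Y * P ^ e₃)) ^ (3 / 4 : ℝ))) ^ (2 / 3 : ℝ)) =
    C₁ ^ (1 / 3 : ℝ) * (C₂ ^ (1 / 4 : ℝ) * C₃ ^ (3 / 4 : ℝ)) ^ (2 / 3 : ℝ) *
      (Y * P ^ (k + e₁ / 3 + 2 * l / 3 + e₂ / 6 + e₃ / 2)) := by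
  rw [mul_mul_rpow_rpow h₁ hY hP, mul_mul_rpow_rpow h₂ hY hP, mul_mul_rpow_rpow h₃ hY hP, ← Real.rpow_natCast P k, ← Real.rpow_natCast P l]
  have e : P ^ (l : ℝ) * (C₂ ^ (1 / 4 : ℝ) * (Y ^ (1 / 4 : ℝ) * P ^ (e₂ * (1 / 4))) *
      (C₃ ^ (3 / 4 : ℝ) * (Y ^ (3 / 4 : ℝ) * P ^ (e₃ * (3 / 4))))) =
      (C₂ ^ (1 / 4 : ℝ) * C₃ ^ (3 / 4 : ℝ)) * (Y * P ^ (l + e₂ * (1 / 4) + e₃ * (3 / 4))) := by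
    have hY' : Y = Y ^ (1 / 4 : ℝ) * Y ^ (3 / 4 : ℝ) := by
      rw [← Real.rpow_add hY]
      norm_num
    rw [Real.rpow_add hP, Real.rpow_add hP]
    nth_rw 3 [hY']
    ring
  rw [e, mul_mul_rpow_rpow (by positivity) hY hP]
  have hY' : Y = Y ^ (1 / 3 : ℝ) * Y ^ (2 / 3 : ℝ) := by
    rw [← Real.rpow_add hY]
    norm_num
  have hP' : P ^ (k + e₁ / 3 + 2 * l / 3 + e₂ / 6 + e₃ / 2) = P ^ (k : ℝ) * P ^ (e₁ * (1 / 3)) *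
      P ^ ((l + e₂ * (1 / 4) + e₃ * (3 / 4)) * (2 / 3)) := by
    rw [← Real.rpow_add hP, ← Real.rpow_add hP]
    congr 1
    ring
  rw [hP']
  nth_rw 3 [hY']
  ring

/-- The iteration: repeated efficient congruencing for the mixed moment. -/
lemma exists_mix_two_four_le {C δ : ℝ} (hC : 0 ≤ C) (hδ : 0 ≤ δ)
    (h : ∀ N : ℕ, 1 ≤ N → (sixes (Icc 1 (N : ℤ)) : ℝ) ≤ C * (N : ℝ) ^ (6 + δ)) (n : ℕ) :
    ∀ a b : ℕ, 1 ≤ a → a ≤ b → ∃ D : ℝ, 0 ≤ D ∧ ∀ p X : ℕ, p.Prime → 5 ≤ p → p ^ (3 ^ n * b) ≤ X →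
      ∀ ξ η : ℤ, ¬ (p : ℤ) ∣ ξ - η → mix 2 4 X p a b ξ η ≤
        D * ((X : ℝ) ^ (6 + δ) * (p : ℝ) ^ (-(2 * a + 4 * b) - n * δ / 6 * (3 * b - a) : ℝ)) := by
  induction n with
  | zero =>
    intro a b ha hab
    refine ⟨C * 2 ^ (6 + δ), by positivity, fun p X hp h5 hX ξ η _ => ?_⟩
    have hX : p ^ b ≤ X := by simpa using hX
    have hXa : p ^ a ≤ X := (Nat.pow_le_pow_right hp.pos hab).trans hX
    have hX0 : 0 < X := (pow_pos hp.pos b).trans_le hX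
    have hP : (0 : ℝ) < p := by exact_mod_cast hp.pos
    have hP1 : (1 : ℝ) ≤ p := by exact_mod_cast hp.one_le
    have hY : (0 : ℝ) < (X : ℝ) ^ (6 + δ) := by positivity
    have h12 : ∀ q (η : ℤ), 0 ≤ mean (fun ψ => resSum X q η ψ ^ 12) :=
      fun q η => mean_nonneg fun _ => pow_nonneg (resSum_nonneg _ _ _ _) _
    have hs : 0 ≤ 6 + δ := by linarith
    refine (mix_two_four_le_sixes X p a b ξ η).trans ?_
    refine (mul_le_mul (Real.rpow_le_rpow (h12 _ _) (mean_resSum_le hC hs h hp.pos hXa ξ)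
      (by norm_num)) (Real.rpow_le_rpow (h12 _ _) (mean_resSum_le hC hs h hp.pos hX η)
      (by norm_num)) (Real.rpow_nonneg (h12 _ _) _) (by positivity)).trans ?_
    have hA : 0 ≤ C * 2 ^ (6 + δ) := by positivity
    set A := C * 2 ^ (6 + δ)
    set Y := (X : ℝ) ^ (6 + δ)
    have e : ∀ x : ℝ, 0 ≤ x → x ^ (1 / 3 : ℝ) * x ^ (2 / 3 : ℝ) = x := by
      intro x hx
      rw [← Real.rpow_add_of_nonneg hx (by norm_num) (by norm_num)]
      norm_num
    clear_value A Y
    rw [mul_mul_rpow_rpow hA hY hP, mul_mul_rpow_rpow hA hY hP, mul_mul_mul_comm, e A hA,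
      mul_mul_mul_comm, e Y hY.le, ← Real.rpow_add hP, ← mul_assoc, ← mul_assoc]
    refine mul_le_mul_of_nonneg_left (Real.rpow_le_rpow_of_exponent_le hP1 ?_) (by positivity)
    have ha' : (0 : ℝ) ≤ a := by positivity
    have hb' : (0 : ℝ) ≤ b := by positivity
    push_cast
    nlinarith [mul_nonneg ha' hδ, mul_nonneg hb' hδ]
  | succ n ih =>
    intro a b ha hab
    obtain ⟨D₁, hD₁, H₁⟩ := ih b (2 * b - a) (by omega) (by omega)
    obtain ⟨D₂, hD₂, H₂⟩ := ih b (3 * b) (by omega) (by omega)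
    have hs : 0 ≤ 6 + δ := by linarith
    have hJ : 0 ≤ C * 2 ^ (6 + δ) := by positivity
    refine ⟨(2 * (b - a) + 1 : ℕ) * (D₁ ^ (1 / 3 : ℝ) *
      (D₂ ^ (1 / 4 : ℝ) * (C * 2 ^ (6 + δ)) ^ (3 / 4 : ℝ)) ^ (2 / 3 : ℝ)), by positivity,
      fun p X hp h5 hX ξ η hξ => ?_⟩
    have hle : ∀ m : ℕ, m ≤ 3 ^ (n + 1) * b → p ^ m ≤ X :=
      fun m hm => (Nat.pow_le_pow_right hp.pos hm).trans hX
    have hX0 : 0 < X := (pow_pos hp.pos _).trans_le hX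
    have hP : (0 : ℝ) < p := by exact_mod_cast hp.pos
    have hP1 : (1 : ℝ) ≤ p := by exact_mod_cast hp.one_le
    have hY : (0 : ℝ) < (X : ℝ) ^ (6 + δ) := by positivity
    have hpow : 3 ^ (n + 1) * b = 3 ^ n * (3 * b) := by ring
    have hXb : p ^ b ≤ X := hle b (Nat.le_mul_of_pos_left _ (by positivity))
    refine (mix_two_four_step hp h5 ha hab hξ
      (fun κ hκ => H₁ p X hp h5 (hle _ ?_) η κ hκ) (fun κ hκ => H₂ p X hp h5 (hle _ hpow.ge) η κ hκ)
      (mean_resSum_le hC hs h hp.pos hXb η)).trans ?_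
    · rw [hpow]
      exact Nat.mul_le_mul_left _ (by omega)
    · rw [mul_assoc, rpow_bookkeeping _ _ hD₁ hD₂ hJ hY hP, ← mul_assoc, ← mul_assoc, ← mul_assoc,
        ← mul_assoc]
      refine mul_le_mul_of_nonneg_left (Real.rpow_le_rpow_of_exponent_le hP1 ?_) (by positivity)
      push_cast [Nat.cast_sub hab, Nat.cast_sub (by omega : a ≤ 2 * b)]
      have ha' : (0 : ℝ) ≤ a := by positivity
      nlinarith [mul_nonneg ha' hδ]

/-- A sum is controlled either by its largest term or by its second largest term. -/
lemma pow_twelve_sum_le {ι : Type*} [DecidableEq ι] (s : Finset ι) {g : ι → ℝ} (hg : ∀ i, 0 ≤ g i) :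
    (∑ i ∈ s, g i) ^ 12 ≤
      2 ^ 12 * ∑ i ∈ s, g i ^ 12 + (2 * #s : ℝ) ^ 12 * ∑ z ∈ s.offDiag, g z.1 ^ 4 * g z.2 ^ 8 := by
  have hnonneg : 0 ≤ ∑ z ∈ s.offDiag, g z.1 ^ 4 * g z.2 ^ 8 :=
    sum_nonneg fun z _ => mul_nonneg (pow_nonneg (hg _) _) (pow_nonneg (hg _) _)
  have hnonneg' : 0 ≤ ∑ i ∈ s, g i ^ 12 := sum_nonneg fun z _ => pow_nonneg (hg _) _
  rcases s.eq_empty_or_nonempty with rfl | hs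
  · simp
  obtain ⟨i, hi, hmax⟩ := s.exists_max_image g hs
  have h0 : 0 ≤ ∑ j ∈ s, g j := sum_nonneg fun j _ => hg j
  have hi12 : g i ^ 12 ≤ ∑ i ∈ s, g i ^ 12 :=
    single_le_sum (f := fun i => g i ^ 12) (fun j _ => pow_nonneg (hg j) _) hi
  have large : ∑ j ∈ s, g j ≤ 2 * g i → (∑ i ∈ s, g i) ^ 12 ≤
      2 ^ 12 * ∑ i ∈ s, g i ^ 12 + (2 * #s : ℝ) ^ 12 * ∑ z ∈ s.offDiag, g z.1 ^ 4 * g z.2 ^ 8 := by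
    intro h
    have h1 := pow_le_pow_left₀ h0 h 12
    rw [mul_pow] at h1
    have : 0 ≤ (2 * #s : ℝ) ^ 12 * ∑ z ∈ s.offDiag, g z.1 ^ 4 * g z.2 ^ 8 := by positivity
    linarith
  have hsplit := add_sum_erase s g hi
  rcases (s.erase i).eq_empty_or_nonempty with he | he
  · apply large
    rw [he, sum_empty] at hsplit
    linarith [hg i]
  obtain ⟨j, hj, hmax'⟩ := (s.erase i).exists_max_image g he
  have hj' := mem_erase.1 hj
  have h2 : ∑ k ∈ s.erase i, g k ≤ #s * g j := by
    refine (sum_le_card_nsmul _ _ _ hmax').trans ?_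
    rw [nsmul_eq_mul]
    exact mul_le_mul_of_nonneg_right (Nat.cast_le.2 (card_erase_le)) (hg j)
  rcases le_total (#s * g j) (g i) with h | h
  · exact large (by linarith)
  · have h3 : ∑ k ∈ s, g k ≤ 2 * #s * g j := by linarith
    have h4 := pow_le_pow_left₀ h0 h3 12
    rw [mul_pow _ (g j)] at h4
    have h5 : g j ^ 12 ≤ ∑ z ∈ s.offDiag, g z.1 ^ 4 * g z.2 ^ 8 := by
      have h6 : g i ^ 4 * g j ^ 8 ≤ ∑ z ∈ s.offDiag, g z.1 ^ 4 * g z.2 ^ 8 :=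
        single_le_sum (f := fun z : ι × ι => g z.1 ^ 4 * g z.2 ^ 8)
          (fun z _ => mul_nonneg (pow_nonneg (hg _) _) (pow_nonneg (hg _) _))
          (show (i, j) ∈ s.offDiag from mem_offDiag.2 ⟨hi, hj'.2, hj'.1.symm⟩)
      have h7 := mul_le_mul_of_nonneg_right (pow_le_pow_left₀ (hg j) (hmax j hj'.2) 4)
        (pow_nonneg (hg j) 8)
      rw [← pow_add] at h7
      exact h7.trans h6
    have h8 := mul_le_mul_of_nonneg_left h5 (by positivity : (0 : ℝ) ≤ (2 * #s : ℝ) ^ 12)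
    linarith

lemma expSum_Icc_eq_sum {X p : ℕ} (hp : 0 < p) (ψ : Dual (12 * X ^ 3)) :
    expSum (Icc 1 (X : ℤ)) mom ψ = ∑ r ∈ range p, expSum (res X p r) mom ψ := by
  have hp' : (0 : ℤ) < p := by exact_mod_cast hp
  have hmap : ∀ n ∈ Icc 1 (X : ℤ), (n % p).toNat ∈ range p := by
    intro n _
    have h1 := Int.emod_nonneg n hp'.ne'
    have h2 := Int.emod_lt_of_pos n hp'
    rw [mem_range]
    omega
  unfold expSum
  rw [← sum_fiberwise_of_maps_to hmap]
  refine sum_congr rfl fun r hr => sum_congr ?_ fun _ _ => rfl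
  ext n
  rw [mem_filter, res, mem_filter]
  refine and_congr_right fun _ => ?_
  have h1 := Int.emod_nonneg n hp'.ne'
  rw [mem_range] at hr
  have h3 : ((r : ℤ)) % p = r := Int.emod_eq_of_lt (by omega) (by exact_mod_cast hr)
  rw [← Int.modEq_iff_dvd, Int.ModEq, h3]
  omega

lemma sixes_Icc_le_mix {X p : ℕ} (hp : 0 < p) :
    (sixes (Icc 1 (X : ℤ)) : ℝ) ≤
      2 ^ 12 * ∑ r ∈ range p, mean (fun ψ => resSum X (p ^ 1) r ψ ^ 12) +
        (2 * p : ℝ) ^ 12 * ∑ z ∈ (range p).offDiag, mix 2 4 X p 1 1 (z.1 : ℤ) (z.2 : ℤ) := by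
  rw [← mean_pow_twelve (X := X) (B := 12 * X ^ 3) (by omega) fun n hn => mem_Icc.1 hn]
  unfold mix
  rw [← mean_sum, ← mean_sum, ← mean_const_mul, ← mean_const_mul, ← mean_add]
  refine mean_mono fun ψ => ?_
  have h := pow_twelve_sum_le (range p) (g := fun r => resSum X (p ^ 1) r ψ)
    (fun r => resSum_nonneg _ _ _ _)
  rw [card_range] at h
  refine le_trans (pow_le_pow_left₀ (norm_nonneg _) ?_ 12) h
  rw [expSum_Icc_eq_sum hp]
  refine (norm_sum_le _ _).trans_eq (sum_congr rfl fun r _ => ?_)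
  rw [resSum, pow_one]

/-- `SixthMomentBound s`: the sixth moment count is `O(N ^ s)`. -/
def SixthMomentBound (s : ℝ) : Prop :=
  ∃ C : ℝ, 0 ≤ C ∧ ∀ N : ℕ, 1 ≤ N → (sixes (Icc 1 (N : ℤ)) : ℝ) ≤ C * (N : ℝ) ^ s

lemma SixthMomentBound.mono {s t : ℝ} (hst : s ≤ t) (h : SixthMomentBound s) :
    SixthMomentBound t := by
  obtain ⟨C, hC, h⟩ := h
  refine ⟨C, hC, fun N hN => (h N hN).trans ?_⟩
  have : (1 : ℝ) ≤ N := by exact_mod_cast hN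
  gcongr

lemma sixes_Icc_le_pow (N : ℕ) : sixes (Icc 1 (N : ℤ)) ≤ N ^ 12 := by
  unfold sixes coinc
  refine (card_filter_le _ _).trans_eq ?_
  simp only [tup, card_product, Fintype.card_piFinset_const, Int.card_Icc, add_sub_cancel_right,
    Int.toNat_natCast]
  ring

lemma exists_sixes_le_div {C δ : ℝ} (hC : 0 ≤ C) (hδ : 0 ≤ δ)
    (h : ∀ N : ℕ, 1 ≤ N → (sixes (Icc 1 (N : ℤ)) : ℝ) ≤ C * (N : ℝ) ^ (6 + δ)) {n : ℕ}
    (hn : 27 ≤ n * δ) :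
    ∃ D : ℝ, 0 ≤ D ∧ ∀ p X : ℕ, p.Prime → 5 ≤ p → p ^ 3 ^ n ≤ X →
      (sixes (Icc 1 (X : ℤ)) : ℝ) ≤ D * ((X : ℝ) ^ (6 + δ) * (p : ℝ) ^ (-1 : ℝ)) := by
  obtain ⟨D, hD, H⟩ := exists_mix_two_four_le hC hδ h n 1 1 le_rfl le_rfl
  refine ⟨2 ^ 12 * (C * 2 ^ (6 + δ)) + 2 ^ 12 * D, by positivity, fun p X hp h5 hX => ?_⟩
  have hP : (0 : ℝ) < p := by exact_mod_cast hp.pos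
  have hP1 : (1 : ℝ) ≤ p := by exact_mod_cast hp.one_le
  have hpX : p ^ 1 ≤ X := (Nat.pow_le_pow_right hp.pos (Nat.one_le_pow _ _ (by norm_num))).trans hX
  refine (sixes_Icc_le_mix hp.pos).trans ?_
  set Y := (X : ℝ) ^ (6 + δ) with hY
  have hY0 : 0 ≤ Y := by positivity
  have h1 : ∑ r ∈ range p, mean (fun ψ => resSum X (p ^ 1) (r : ℤ) ψ ^ 12) ≤
      p * (C * 2 ^ (6 + δ) * (Y * (p : ℝ) ^ (-((1 : ℕ) * (6 + δ))))) := by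
    have hs : 0 ≤ 6 + δ := by linarith
    refine (sum_le_card_nsmul (range p)
      (fun r : ℕ => mean (fun ψ => resSum X (p ^ 1) (r : ℤ) ψ ^ 12)) _ fun r _ =>
      mean_resSum_le hC hs h hp.pos hpX r).trans_eq ?_
    rw [card_range, nsmul_eq_mul]
  have h2 : ∑ z ∈ (range p).offDiag, mix 2 4 X p 1 1 (z.1 : ℤ) (z.2 : ℤ) ≤
      (p ^ 2 : ℝ) * (D * (Y * (p : ℝ) ^ (-(2 * (1 : ℕ) + 4 * (1 : ℕ)) -
        n * δ / 6 * (3 * (1 : ℕ) - (1 : ℕ)) : ℝ))) := by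
    refine (sum_le_card_nsmul _ _ _ fun z hz => H p X hp h5 (by simpa using hX) _ _ ?_).trans ?_
    · rw [mem_offDiag, mem_range, mem_range] at hz
      intro hd
      have := Int.eq_zero_of_abs_lt_dvd hd (by rw [abs_lt]; omega)
      omega
    · rw [nsmul_eq_mul]
      refine mul_le_mul_of_nonneg_right ?_ (by positivity)
      have : #(range p).offDiag ≤ p ^ 2 := by
        rw [offDiag_card, card_range, sq]
        exact Nat.sub_le _ _
      exact_mod_cast this
  have e1 : (p : ℝ) * (p : ℝ) ^ (-((1 : ℕ) * (6 + δ))) ≤ (p : ℝ) ^ (-1 : ℝ) := by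
    nth_rw 1 [← Real.rpow_one (p : ℝ)]
    rw [← Real.rpow_add hP]
    apply Real.rpow_le_rpow_of_exponent_le hP1
    push_cast
    linarith
  have e2 : (p : ℝ) ^ 14 * (p : ℝ) ^ (-(2 * (1 : ℕ) + 4 * (1 : ℕ)) -
        n * δ / 6 * (3 * (1 : ℕ) - (1 : ℕ)) : ℝ) ≤ (p : ℝ) ^ (-1 : ℝ) := by
    rw [← Real.rpow_natCast (p : ℝ) 14, ← Real.rpow_add hP]
    apply Real.rpow_le_rpow_of_exponent_le hP1
    push_cast
    linarith
  have g1 := mul_le_mul_of_nonneg_left e1 (by positivity : 0 ≤ 2 ^ 12 * (C * 2 ^ (6 + δ)) * Y)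
  have g2 := mul_le_mul_of_nonneg_left e2 (by positivity : 0 ≤ 2 ^ 12 * D * Y)
  have f1 := mul_le_mul_of_nonneg_left h1 (by positivity : (0 : ℝ) ≤ 2 ^ 12)
  have f2 := mul_le_mul_of_nonneg_left h2 (by positivity : (0 : ℝ) ≤ (2 * p : ℝ) ^ 12)
  refine (add_le_add f1 f2).trans ?_
  refine le_trans (le_of_eq ?_) ((add_le_add g1 g2).trans (le_of_eq ?_)) <;> ring

lemma exists_prime_pow_le {m X : ℕ} (hm : m ≠ 0) (hX : 10 ^ m ≤ X) :
    ∃ p, p.Prime ∧ 5 ≤ p ∧ p ^ m ≤ X ∧ X ≤ (2 * p) ^ m := by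
  have hex : ∃ t, X < (2 * (t + 1)) ^ m :=
    ⟨X, lt_of_lt_of_le (by omega : X < 2 * (X + 1)) (Nat.le_self_pow hm _)⟩
  classical
  set t := Nat.find hex with ht
  have h1 : X < (2 * (t + 1)) ^ m := Nat.find_spec hex
  have h4 : 5 ≤ t + 1 := by
    have := (Nat.pow_lt_pow_iff_left hm).1 (hX.trans_lt h1)
    omega
  have h2 : (2 * t) ^ m ≤ X := by
    have := Nat.find_min hex (m := t - 1) (by omega)
    rw [show t - 1 + 1 = t by omega] at this
    omega
  obtain ⟨p, hp, h5, h6⟩ := Nat.exists_prime_lt_and_le_two_mul t (by omega)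
  refine ⟨p, hp, by omega, (Nat.pow_le_pow_left h6 m).trans h2, h1.le.trans ?_⟩
  exact Nat.pow_le_pow_left (by omega) m

lemma SixthMomentBound.improve {δ : ℝ} (hδ : 0 ≤ δ) (h : SixthMomentBound (6 + δ)) {n : ℕ}
    (hn : 27 ≤ n * δ) (hδ' : 0 ≤ 6 + δ - 1 / 3 ^ n) : SixthMomentBound (6 + δ - 1 / 3 ^ n) := by
  obtain ⟨C, hC, h⟩ := h
  obtain ⟨D, hD, H⟩ := exists_sixes_le_div hC hδ h hn
  refine ⟨2 * D + (10 ^ 3 ^ n) ^ 12, by positivity, fun N hN => ?_⟩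
  have hN1 : (1 : ℝ) ≤ N := by exact_mod_cast hN
  have hN0 : (0 : ℝ) < N := by linarith
  have hm : 3 ^ n ≠ 0 := by positivity
  rcases le_total (10 ^ 3 ^ n) N with hX | hX
  · obtain ⟨p, hp, h5, hpX, hXp⟩ := exists_prime_pow_le hm hX
    refine (H p N hp h5 hpX).trans ?_
    have hP : (0 : ℝ) < p := by exact_mod_cast hp.pos
    have key : (p : ℝ) ^ (-1 : ℝ) ≤ 2 * (N : ℝ) ^ (-(1 / 3 ^ n) : ℝ) := by
      rw [Real.rpow_neg hP.le, Real.rpow_neg hN0.le, Real.rpow_one, ← div_eq_mul_inv,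
        inv_le_comm₀ hP (by positivity), inv_div, div_le_iff₀ (by norm_num), mul_comm]
      have h1 : (N : ℝ) ≤ (2 * p : ℝ) ^ (3 ^ n) := by exact_mod_cast hXp
      have h2 := Real.rpow_le_rpow hN0.le h1 (by positivity : (0 : ℝ) ≤ 1 / 3 ^ n)
      refine h2.trans_eq ?_
      rw [← Real.rpow_natCast, ← Real.rpow_mul (by positivity)]
      push_cast
      rw [mul_one_div_cancel (by positivity), Real.rpow_one]
    rw [sub_eq_add_neg, Real.rpow_add hN0 (6 + δ)]
    have h3 := mul_le_mul_of_nonneg_left key (by positivity : 0 ≤ D * (N : ℝ) ^ (6 + δ))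
    have h4 : 0 ≤ ((10 : ℝ) ^ 3 ^ n) ^ 12 * ((N : ℝ) ^ (6 + δ) * (N : ℝ) ^ (-(1 / 3 ^ n) : ℝ)) := by
      positivity
    linarith
  · have h1 : (sixes (Icc 1 (N : ℤ)) : ℝ) ≤ ((10 : ℝ) ^ 3 ^ n) ^ 12 := by
      have := (sixes_Icc_le_pow N).trans (Nat.pow_le_pow_left hX 12)
      exact_mod_cast this
    have h2 := Real.one_le_rpow hN1 hδ'
    have h3 := mul_le_mul_of_nonneg_left h2
      (by positivity : 0 ≤ 2 * D + ((10 : ℝ) ^ 3 ^ n) ^ 12)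
    linarith

/-- The cubic case of Vinogradov's mean value theorem at the critical exponent. -/
theorem sixthMomentBound {ε : ℝ} (hε : 0 < ε) : SixthMomentBound (6 + ε) := by
  obtain ⟨n, hn⟩ := exists_nat_ge (27 / ε)
  rw [div_le_iff₀ hε] at hn
  have hκ : (0 : ℝ) < 1 / 3 ^ n := by positivity
  have hκ1 : (1 : ℝ) / 3 ^ n ≤ 1 := by
    rw [div_le_one (by positivity)]
    exact one_le_pow₀ (by norm_num)
  have key : ∀ k : ℕ, SixthMomentBound (6 + max ε (6 - k * (1 / 3 ^ n))) := by
    intro k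
    induction k with
    | zero =>
      refine SixthMomentBound.mono (s := 12) ?_ ⟨1, zero_le_one, fun N _ => ?_⟩
      · have := le_max_right ε (6 - (0 : ℕ) * (1 / 3 ^ n))
        push_cast at this ⊢
        linarith
      · rw [one_mul]
        have := sixes_Icc_le_pow N
        exact_mod_cast this
    | succ k ih =>
      set δ := max ε (6 - k * (1 / 3 ^ n)) with hδ
      have h1 : ε ≤ δ := le_max_left _ _
      have h2 : 27 ≤ n * δ := hn.trans (mul_le_mul_of_nonneg_left h1 (by positivity))
      refine (ih.improve (hε.le.trans h1) h2 (by linarith)).mono ?_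
      have h3 : δ ≤ max ε (6 - (k + 1 : ℕ) * (1 / 3 ^ n)) + 1 / 3 ^ n := by
        refine max_le ?_ ?_
        · linarith [le_max_left ε (6 - (k + 1 : ℕ) * (1 / 3 ^ n : ℝ))]
        · have := le_max_right ε (6 - (k + 1 : ℕ) * (1 / 3 ^ n : ℝ))
          push_cast at this ⊢
          linarith
      linarith
  obtain ⟨k, hk⟩ := exists_nat_ge (6 / (1 / 3 ^ n : ℝ))
  rw [div_le_iff₀ hκ] at hk
  have := key k
  rwa [max_eq_left (by linarith)] at this

/-- The pairs `(a, h)` with `1 ≤ a ≤ N` and `|h| ≤ N`. -/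
noncomputable def shifts (N : ℕ) : Finset (ℤ × ℤ) := Icc 1 (N : ℤ) ×ˢ Icc (-N : ℤ) N

lemma mem_shifts {N : ℕ} {z : ℤ × ℤ} :
    z ∈ shifts N ↔ (1 ≤ z.1 ∧ z.1 ≤ N) ∧ -(N : ℤ) ≤ z.2 ∧ z.2 ≤ N := by
  simp [shifts]

/-- The change of the power sums of a quintuple with vanishing linear and cubic part and quadratic
part `h` under translation by `a`. -/
def shiftVec (z : ℤ × ℤ) : ℤ × ℤ × ℤ := (0, z.2, 3 * z.1 * z.2)

lemma card_shifts_filter_ne_le (N : ℕ) (a : ℤ) {u : ℤ} (hu : u ≠ 0) :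
    #{z ∈ shifts N | 3 * (z.1 - a) * z.2 = u} ≤ 2 * #u.natAbs.divisors := by
  classical
  have hcard : #((u.natAbs.divisors.image fun n : ℕ => (n : ℤ)) ∪
      u.natAbs.divisors.image fun n : ℕ => -(n : ℤ)) ≤ 2 * #u.natAbs.divisors := by
    refine (card_union_le _ _).trans ?_
    rw [two_mul]
    exact add_le_add card_image_le card_image_le
  refine (card_le_card_of_injOn Prod.snd (fun z hz => ?_) ?_).trans hcard
  · simp only [coe_filter, Set.mem_ofPred_eq] at hz
    have hd : z.2.natAbs ∈ u.natAbs.divisors := by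
      rw [Nat.mem_divisors]
      exact ⟨Int.natAbs_dvd_natAbs.2 ⟨3 * (z.1 - a), by rw [← hz.2]; ring⟩, Int.natAbs_ne_zero.2 hu⟩
    rw [mem_coe, mem_union, mem_image, mem_image]
    rcases Int.natAbs_eq z.2 with h | h
    · exact Or.inl ⟨_, hd, h.symm⟩
    · exact Or.inr ⟨_, hd, h.symm⟩
  · intro z hz z' hz' h
    simp only [coe_filter, Set.mem_ofPred_eq] at hz hz'
    have h0 : z'.2 ≠ 0 := by
      intro h0
      apply hu
      rw [← hz'.2, h0, mul_zero]
    have := hz.2.trans hz'.2.symm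
    rw [h] at this
    have := mul_right_cancel₀ h0 this
    exact Prod.ext (by linarith) h

lemma card_shifts_filter_zero_le {N : ℕ} (hN : 1 ≤ N) (a : ℤ) :
    #{z ∈ shifts N | 3 * (z.1 - a) * z.2 = 0} ≤ 4 * N := by
  have hsub : ({z ∈ shifts N | 3 * (z.1 - a) * z.2 = 0} : Finset (ℤ × ℤ)) ⊆
      ({a} : Finset ℤ) ×ˢ Icc (-N : ℤ) N ∪ Icc 1 (N : ℤ) ×ˢ ({0} : Finset ℤ) := by
    intro z hz
    rw [mem_filter, shifts, mem_product] at hz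
    rw [mem_union, mem_product, mem_product, mem_singleton, mem_singleton]
    rcases mul_eq_zero.1 hz.2 with h | h
    · exact Or.inl ⟨by linarith, hz.1.2⟩
    · exact Or.inr ⟨hz.1.1, h⟩
  refine (card_le_card hsub).trans ((card_union_le _ _).trans ?_)
  rw [card_product, card_product, card_singleton, card_singleton, Int.card_Icc, Int.card_Icc]
  omega

/-- The pairs of shifts whose vectors differ by `(0, q, c)`. -/
noncomputable def shiftPairs (N : ℕ) (q c : ℤ) : Finset ((ℤ × ℤ) × (ℤ × ℤ)) :=
  {z ∈ shifts N ×ˢ shifts N | z.2.2 - z.1.2 = q ∧ 3 * z.2.1 * z.2.2 - 3 * z.1.1 * z.1.2 = c}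

lemma card_shiftPairs_le_sum (N : ℕ) (q c : ℤ) :
    #(shiftPairs N q c) ≤
      ∑ a ∈ Icc 1 (N : ℤ), #{z ∈ shifts N | 3 * (z.1 - a) * z.2 = c - 3 * a * q} := by
  have hmap : ∀ z ∈ shiftPairs N q c, z.1.1 ∈ Icc 1 (N : ℤ) := by
    intro z hz
    rw [shiftPairs, mem_filter, mem_product, mem_shifts] at hz
    exact mem_Icc.2 hz.1.1.1
  rw [card_eq_sum_card_fiberwise hmap]
  refine sum_le_sum fun a _ => card_le_card_of_injOn Prod.snd (fun z hz => ?_) ?_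
  · simp only [shiftPairs, coe_filter, mem_filter, mem_product, Set.mem_ofPred_eq] at hz ⊢
    obtain ⟨⟨⟨-, h⟩, h1, h2⟩, rfl⟩ := hz
    refine ⟨h, ?_⟩
    rw [← h1, ← h2]
    ring
  · intro z hz z' hz' h
    simp only [shiftPairs, coe_filter, mem_filter, mem_product, Set.mem_ofPred_eq] at hz hz'
    refine Prod.ext (Prod.ext (hz.2.trans hz'.2.symm) ?_) h
    have h1 := hz.1.2.1
    have h2 := hz'.1.2.1
    rw [h] at h1
    linarith

lemma exists_card_shiftPairs_le {ε : ℝ} (hε : 0 < ε) : ∃ C : ℝ, 0 ≤ C ∧ ∀ N : ℕ, 1 ≤ N →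
    ∀ q c : ℤ, |q| ≤ 2 * N → |c| ≤ 6 * N ^ 2 → (q ≠ 0 ∨ c ≠ 0) →
      (#(shiftPairs N q c) : ℝ) ≤ C * (N : ℝ) ^ (1 + ε) := by
  obtain ⟨D, hD, hdiv⟩ := exists_card_divisors_le (ε := ε / 2) (by linarith)
  refine ⟨2 * D * 12 ^ (ε / 2) + 4, by positivity, fun N hN q c hq hc hqc => ?_⟩
  have hN1 : (1 : ℝ) ≤ N := by exact_mod_cast hN
  have hN0 : (0 : ℝ) < N := by linarith
  have hNε : (1 : ℝ) ≤ (N : ℝ) ^ ε := Real.one_le_rpow hN1 hε.le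
  set G : ℤ → ℝ := fun a => (#{z ∈ shifts N | 3 * (z.1 - a) * z.2 = c - 3 * a * q} : ℝ) with hG
  have h1 : (#(shiftPairs N q c) : ℝ) ≤ ∑ a ∈ Icc 1 (N : ℤ), G a :=
    (Nat.cast_le.2 (card_shiftPairs_le_sum N q c)).trans_eq (Nat.cast_sum _ _)
  set s₀ : Finset ℤ := {a ∈ Icc 1 (N : ℤ) | c - 3 * a * q = 0} with hs₀
  have hs₀card : #s₀ ≤ 1 := by
    rw [card_le_one]
    intro a ha b hb
    rw [hs₀, mem_filter] at ha hb
    rcases eq_or_ne q 0 with hq0 | hq0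
    · exfalso
      rw [hq0] at ha
      rcases hqc with h | h
      · exact h hq0
      · exact h (by linarith [ha.2])
    · have := ha.2.trans hb.2.symm
      exact mul_right_cancel₀ (mul_ne_zero (by norm_num : (3 : ℤ) ≠ 0) hq0) (by linarith)
  have hmain : ∀ a ∈ Icc 1 (N : ℤ), G a ≤
      2 * D * 12 ^ (ε / 2) * (N : ℝ) ^ ε + if c - 3 * a * q = 0 then 4 * (N : ℝ) else 0 := by
    intro a ha
    rw [mem_Icc] at ha
    split_ifs with h
    · have := card_shifts_filter_zero_le hN a
      have h2 : G a ≤ 4 * N := by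
        simp only [hG, h]
        exact_mod_cast this
      have : 0 ≤ 2 * D * 12 ^ (ε / 2) * (N : ℝ) ^ ε := by positivity
      linarith
    · have h2 := card_shifts_filter_ne_le N a h
      have hpos : 1 ≤ (c - 3 * a * q).natAbs := Nat.one_le_iff_ne_zero.2 (Int.natAbs_ne_zero.2 h)
      have h3 := hdiv _ hpos
      have h4 : ((c - 3 * a * q).natAbs : ℤ) ≤ 12 * N ^ 2 := by
        rw [Int.natCast_natAbs]
        have e1 : |3 * a * q| ≤ 3 * N * (2 * N) := by
          rw [abs_mul, abs_mul, abs_of_pos (by norm_num : (0 : ℤ) < 3), abs_of_pos (by omega : 0 < a)]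
          have : 0 ≤ |q| := abs_nonneg q
          have : 3 * a ≤ 3 * N := by linarith
          gcongr
        have e2 := abs_sub c (3 * a * q)
        nlinarith
      have h5 : ((c - 3 * a * q).natAbs : ℝ) ≤ 12 * (N : ℝ) ^ 2 := by exact_mod_cast h4
      have h6 : ((c - 3 * a * q).natAbs : ℝ) ^ (ε / 2) ≤ 12 ^ (ε / 2) * (N : ℝ) ^ ε := by
        refine (Real.rpow_le_rpow (by positivity) h5 (by linarith)).trans_eq ?_
        rw [Real.mul_rpow (by norm_num) (by positivity), ← Real.rpow_natCast, ← Real.rpow_mul hN0.le]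
        congr 2
        push_cast
        ring
      have h7 : G a ≤ 2 * #(c - 3 * a * q).natAbs.divisors :=
        (Nat.cast_le.2 h2).trans_eq (by push_cast; rfl)
      have h8 := mul_le_mul_of_nonneg_left h6 (by linarith : 0 ≤ 2 * D)
      linarith
  refine h1.trans ((sum_le_sum hmain).trans ?_)
  rw [sum_add_distrib, sum_const, ← sum_filter, sum_const, Int.card_Icc, nsmul_eq_mul, nsmul_eq_mul,
    Real.rpow_add hN0, Real.rpow_one, add_sub_cancel_right, Int.toNat_natCast]
  have h2 : (#s₀ : ℝ) ≤ 1 := by exact_mod_cast hs₀card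
  have h3 : (#s₀ : ℝ) * (4 * N) ≤ 1 * (4 * N) := by gcongr
  have h4 : 4 * (N : ℝ) * 1 ≤ 4 * N * (N : ℝ) ^ ε := by gcongr
  linarith

lemma card_shiftPairs_zero_le {N : ℕ} (hN : 1 ≤ N) : #(shiftPairs N 0 0) ≤ 4 * N ^ 2 := by
  refine (card_shiftPairs_le_sum N 0 0).trans ?_
  refine (sum_le_card_nsmul _ _ (4 * N) fun a _ => ?_).trans_eq ?_
  · simpa using card_shifts_filter_zero_le hN a
  · rw [Int.card_Icc, add_sub_cancel_right, Int.toNat_natCast, smul_eq_mul]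
    ring

/-- The family of power sums of quadruples perturbed by the shift vectors. -/
lemma coinc_shift_le_sum (N : ℕ) (S : Finset ℤ) :
    coinc (tup 4 S ×ˢ shifts N) (fun p => ps p.1 + shiftVec p.2)
        (tup 4 S ×ˢ shifts N) (fun p => ps p.1 + shiftVec p.2) ≤
      ∑ p ∈ nearPairs S (2 * N) (6 * N ^ 2),
        #(shiftPairs N (ps p.1 - ps p.2).2.1 (ps p.1 - ps p.2).2.2) := by
  unfold coinc
  have hvec : ∀ {x y : Fin 4 → ℤ} {r r' : ℤ × ℤ}, ps x + shiftVec r = ps y + shiftVec r' →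
      (ps x - ps y).1 = 0 ∧ r'.2 - r.2 = (ps x - ps y).2.1 ∧
        3 * r'.1 * r'.2 - 3 * r.1 * r.2 = (ps x - ps y).2.2 := by
    intro x y r r' h
    rw [Prod.ext_iff, Prod.ext_iff] at h
    simp only [shiftVec, Prod.fst_add, Prod.snd_add] at h
    simp only [Prod.fst_sub, Prod.snd_sub]
    refine ⟨by linarith, by linarith, by linarith⟩
  rw [card_eq_sum_card_fiberwise (f := fun z => (z.1.1, z.2.1))
    (t := nearPairs S (2 * N) (6 * N ^ 2))]
  · refine sum_le_sum fun p _ => card_le_card_of_injOn (fun z => (z.1.2, z.2.2)) (fun z hz => ?_) ?_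
    · simp only [shiftPairs, coe_filter, mem_filter, mem_product, Set.mem_ofPred_eq] at hz ⊢
      obtain ⟨⟨⟨⟨-, h1⟩, -, h2⟩, h⟩, rfl⟩ := hz
      exact ⟨⟨h1, h2⟩, (hvec h).2⟩
    · rintro ⟨⟨x, r⟩, y, r'⟩ hz ⟨⟨x', s⟩, y', s'⟩ hz' h
      simp only [coe_filter, mem_filter, Set.mem_ofPred_eq] at hz hz'
      have := hz.2.trans hz'.2.symm
      simp only [Prod.mk.injEq] at this h ⊢
      exact ⟨⟨this.1, h.1⟩, this.2, h.2⟩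
  · intro z hz
    simp only [coe_filter, mem_product, Set.mem_ofPred_eq, mem_shifts] at hz
    obtain ⟨⟨⟨hx, ⟨a1, a2⟩, a3, a4⟩, hy, ⟨b1, b2⟩, b3, b4⟩, h⟩ := hz
    obtain ⟨h1, h2, h3⟩ := hvec h
    rw [mem_coe, mem_nearPairs, ← h2, ← h3]
    refine ⟨⟨hx, hy⟩, h1, abs_le.2 ⟨by linarith, by linarith⟩, ?_⟩
    have key : ∀ a t : ℤ, 1 ≤ a → a ≤ N → -(N : ℤ) ≤ t → t ≤ N → |3 * a * t| ≤ 3 * N * N := by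
      intro a t h1 h2 h3 h4
      rw [abs_mul, abs_of_pos (by linarith : 0 < 3 * a)]
      have h5 : |t| ≤ N := abs_le.2 ⟨h3, h4⟩
      have h6 : 3 * a ≤ 3 * N := by linarith
      gcongr
    have k1 := key _ _ a1 a2 a3 a4
    have k2 := key _ _ b1 b2 b3 b4
    have := abs_sub (3 * z.2.2.1 * z.2.2.2) (3 * z.1.2.1 * z.1.2.2)
    nlinarith

lemma mean_pow_eight_le_sixes {N B : ℕ} (hB : 6 * N ^ 3 ≤ B) {S : Finset ℤ}
    (hS : ∀ n ∈ S, 1 ≤ n ∧ n ≤ N) :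
    mean (B := B) (fun ψ => ‖expSum S mom ψ‖ ^ 8) ≤ (sixes S : ℝ) ^ (2 / 3 : ℝ) := by
  have h := mean_rpow_mul_rpow_le (B := B) (θ := 2 / 3) (by norm_num) (by norm_num)
    (f := fun ψ => ‖expSum S mom ψ‖ ^ 12) (g := fun _ => 1) (fun ψ => by positivity)
    (fun _ => zero_le_one)
  have h1 : mean (B := B) (fun _ => (1 : ℝ)) = 1 := by
    unfold mean
    rw [sum_const, card_univ, nsmul_eq_mul, mul_one, div_self card_dual_pos.ne']
  rw [h1, Real.one_rpow, mul_one, mean_pow_twelve hB hS] at h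
  refine le_trans (le_of_eq ?_) h
  congr 1
  funext ψ
  rw [mul_one, ← Real.rpow_natCast, ← Real.rpow_natCast,
    ← Real.rpow_mul (norm_nonneg _)]
  norm_num

lemma mean_pow_eight {N B : ℕ} (hB : 4 * N ^ 3 ≤ B) {S : Finset ℤ}
    (hS : ∀ n ∈ S, 1 ≤ n ∧ n ≤ N) :
    mean (B := B) (fun ψ => ‖expSum S mom ψ‖ ^ 8) = coinc (tup 4 S) ps (tup 4 S) ps := by
  rw [← mean_norm_sq (B := B)]
  · congr 1
    funext ψ
    rw [expSum_tup, norm_pow]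
    ring
  · intro t ht s hs
    exact (inBox_ps_sub hS ht hs).mono hB

lemma coinc_quadruples_le {N : ℕ} {S : Finset ℤ} (hS : ∀ n ∈ S, 1 ≤ n ∧ n ≤ N) :
    (coinc (tup 4 S) ps (tup 4 S) ps : ℝ) ≤ (sixes S : ℝ) ^ (2 / 3 : ℝ) := by
  rw [← mean_pow_eight (N := N) (B := 6 * N ^ 3) (by omega) hS]
  exact mean_pow_eight_le_sixes le_rfl hS

/-- The number of coincidences among quadruples perturbed by shift vectors. -/
noncomputable def shiftedMoment (N : ℕ) (S : Finset ℤ) : ℕ :=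
  coinc (tup 4 S ×ˢ shifts N) (fun p => ps p.1 + shiftVec p.2)
    (tup 4 S ×ˢ shifts N) (fun p => ps p.1 + shiftVec p.2)

lemma exists_shiftedMoment_le {ε : ℝ} (hε : 0 < ε) : ∃ C : ℝ, 0 ≤ C ∧ ∀ N : ℕ, 1 ≤ N →
    (shiftedMoment N (Icc 1 ((2 * N : ℕ) : ℤ)) : ℝ) ≤ C * (N : ℝ) ^ (6 + 2 * ε) := by
  obtain ⟨C₁, hC₁, h₁⟩ := exists_card_nearPairs_le hε
  obtain ⟨C₂, hC₂, h₂⟩ := exists_card_shiftPairs_le hε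
  obtain ⟨C₃, hC₃, h₃⟩ := sixthMomentBound hε
  refine ⟨C₁ * C₂ + 4 * (C₃ * 2 ^ (6 + ε)) ^ (2 / 3 : ℝ), by positivity, fun N hN => ?_⟩
  have hN1 : (1 : ℝ) ≤ N := by exact_mod_cast hN
  have hN0 : (0 : ℝ) < N := by linarith
  set S := Icc 1 ((2 * N : ℕ) : ℤ) with hS
  have hS' : S = Icc 1 (2 * (N : ℤ)) := by
    rw [hS]
    push_cast
    rfl
  set P := nearPairs S (2 * N) (6 * N ^ 2) with hP
  have hcardP : (#P : ℝ) ≤ C₁ * (N : ℝ) ^ (5 + ε) := by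
    rw [hP, hS']
    exact h₁ N hN
  have hdiag : (#{p ∈ P | ps p.1 = ps p.2} : ℝ) ≤
      (C₃ * 2 ^ (6 + ε)) ^ (2 / 3 : ℝ) * (N : ℝ) ^ (4 + 2 * ε) := by
    have e1 : #{p ∈ P | ps p.1 = ps p.2} ≤ coinc (tup 4 S) ps (tup 4 S) ps := by
      unfold coinc
      refine card_le_card fun p hp => ?_
      rw [mem_filter, mem_nearPairs] at hp
      rw [mem_filter, mem_product]
      exact ⟨hp.1.1, hp.2⟩
    have e2 := coinc_quadruples_le (N := 2 * N) (S := S) fun n hn => mem_Icc.1 hn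
    have e3 := h₃ (2 * N) (by omega)
    refine (Nat.cast_le.2 e1).trans (e2.trans ?_)
    refine (Real.rpow_le_rpow (Nat.cast_nonneg _) e3 (by norm_num)).trans ?_
    rw [Nat.cast_mul, Nat.cast_ofNat, Real.mul_rpow (by norm_num) hN0.le, ← mul_assoc,
      Real.mul_rpow (by positivity) (by positivity), ← Real.rpow_mul hN0.le]
    refine mul_le_mul_of_nonneg_left (Real.rpow_le_rpow_of_exponent_le hN1 ?_) (by positivity)
    linarith
  have hterm : ∀ p ∈ P, (#(shiftPairs N (ps p.1 - ps p.2).2.1 (ps p.1 - ps p.2).2.2) : ℝ) ≤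
      C₂ * (N : ℝ) ^ (1 + ε) + if ps p.1 = ps p.2 then 4 * (N : ℝ) ^ 2 else 0 := by
    intro p hp
    rw [hP, mem_nearPairs] at hp
    split_ifs with h
    · rw [h, sub_self]
      have e1 : (#(shiftPairs N 0 0) : ℝ) ≤ 4 * (N : ℝ) ^ 2 := by
        exact_mod_cast card_shiftPairs_zero_le hN
      have e2 : 0 ≤ C₂ * (N : ℝ) ^ (1 + ε) := by positivity
      exact e1.trans (by linarith)
    · rw [add_zero]
      refine h₂ N hN _ _ hp.2.2.1 hp.2.2.2 ?_
      by_contra! h0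
      exact h (sub_eq_zero.1 (Prod.ext hp.2.1 (Prod.ext h0.1 h0.2)))
  have h4 : (shiftedMoment N S : ℝ) ≤
      ∑ p ∈ P, (#(shiftPairs N (ps p.1 - ps p.2).2.1 (ps p.1 - ps p.2).2.2) : ℝ) :=
    (Nat.cast_le.2 (coinc_shift_le_sum N S)).trans_eq (Nat.cast_sum _ _)
  refine h4.trans ((sum_le_sum hterm).trans ?_)
  rw [sum_add_distrib, sum_const, ← sum_filter, sum_const, nsmul_eq_mul, nsmul_eq_mul]
  have f1 : (N : ℝ) ^ (6 + 2 * ε) = (N : ℝ) ^ (5 + ε) * (N : ℝ) ^ (1 + ε) := by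
    rw [← Real.rpow_add hN0]
    congr 1
    ring
  have f2 : (N : ℝ) ^ (6 + 2 * ε) = (N : ℝ) ^ (4 + 2 * ε) * (N : ℝ) ^ 2 := by
    rw [← Real.rpow_natCast, ← Real.rpow_add hN0]
    congr 1
    push_cast
    ring
  have g1 := mul_le_mul_of_nonneg_right hcardP (by positivity : 0 ≤ C₂ * (N : ℝ) ^ (1 + ε))
  have g2 := mul_le_mul_of_nonneg_right hdiag (by positivity : 0 ≤ 4 * (N : ℝ) ^ 2)
  refine (add_le_add g1 g2).trans_eq ?_
  rw [add_mul]
  nth_rw 1 [f1]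
  rw [f2]
  ring

/-- The solutions of the system as pairs of quintuples. -/
noncomputable def solutions (N : ℕ) : Finset ((Fin 5 → ℤ) × (Fin 5 → ℤ)) :=
  {p ∈ tup 5 (Icc 1 (N : ℤ)) ×ˢ tup 5 (Icc 1 (N : ℤ)) |
    (ps p.1 - ps p.2).1 = 0 ∧ |(ps p.1 - ps p.2).2.1| ≤ N ∧ (ps p.1 - ps p.2).2.2 = 0}

lemma card_solutions_mul_le (N : ℕ) :
    #(solutions N) * N ≤ coinc (tup 5 (Icc 1 ((2 * N : ℕ) : ℤ))) ps
      (tup 5 (Icc 1 ((2 * N : ℕ) : ℤ)) ×ˢ shifts N) (fun p => ps p.1 + shiftVec p.2) := by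
  have h : #(solutions N) * N = #(solutions N ×ˢ Icc 1 (N : ℤ)) := by
    rw [card_product, Int.card_Icc, add_sub_cancel_right, Int.toNat_natCast]
  rw [h]
  unfold coinc
  refine card_le_card_of_injOn (fun z => ((fun i => z.2 + 1 * z.1.1 i),
    ((fun i => z.2 + 1 * z.1.2 i), (z.2, (ps z.1.1 - ps z.1.2).2.1)))) (fun z hz => ?_) ?_
  · simp only [solutions, coe_product, coe_filter, coe_Icc, Set.mem_prod, Set.mem_ofPred_eq,
      mem_product, mem_tup, mem_Icc, Set.mem_Icc, mem_shifts] at hz ⊢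
    obtain ⟨⟨⟨hx, hy⟩, h1, h2, h3⟩, ha1, ha2⟩ := hz
    refine ⟨⟨fun i => ?_, fun i => ?_, ⟨ha1, ha2⟩, abs_le.1 h2⟩, ?_⟩
    · have := hx i
      push_cast
      exact ⟨by linarith, by linarith⟩
    · have := hy i
      push_cast
      exact ⟨by linarith, by linarith⟩
    · rw [ps_affine, ps_affine]
      simp only [aff, shiftVec, Prod.mk_add_mk, Prod.fst_sub, Prod.snd_sub] at h1 h3 ⊢
      have h1' := sub_eq_zero.1 h1
      have h3' := sub_eq_zero.1 h3
      rw [h1', h3']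
      refine Prod.ext (by ring) (Prod.ext (by ring) (by ring))
  · rintro ⟨⟨x, y⟩, a⟩ - ⟨⟨x', y'⟩, a'⟩ - h
    simp only [Prod.mk.injEq] at h ⊢
    obtain ⟨hx, hy, rfl, -⟩ := h
    refine ⟨⟨funext fun i => ?_, funext fun i => ?_⟩, rfl⟩
    · simpa using congrFun hx i
    · simpa using congrFun hy i

lemma coinc_quintuples_le {N M : ℕ} (hNM : N ≤ M) {S : Finset ℤ} (hS : ∀ n ∈ S, 1 ≤ n ∧ n ≤ M) :
    (coinc (tup 5 S) ps (tup 5 S ×ˢ shifts N) (fun p => ps p.1 + shiftVec p.2) : ℝ) ≤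
      (sixes S : ℝ) ^ (1 / 2 : ℝ) * (shiftedMoment N S : ℝ) ^ (1 / 2 : ℝ) := by
  set B := 10 * M ^ 3 with hB
  have h := mean_rpow_mul_rpow_le (B := B) (θ := 1 / 2) (by norm_num) (by norm_num)
    (f := fun ψ => ‖expSum S mom ψ‖ ^ 12)
    (g := fun ψ => ‖expSum S mom ψ‖ ^ 8 * ‖expSum (shifts N) shiftVec ψ‖ ^ 2)
    (fun ψ => by positivity) (fun ψ => by positivity)
  have h1 : mean (B := B) (fun ψ => ‖expSum S mom ψ‖ ^ 8 * ‖expSum (shifts N) shiftVec ψ‖ ^ 2) =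
      shiftedMoment N S := by
    unfold shiftedMoment
    rw [← mean_norm_sq (B := B)]
    · congr 1
      funext ψ
      rw [congrFun (expSum_product _ _ _ _) ψ, expSum_tup, norm_mul, norm_pow]
      ring
    · rintro ⟨x, a, t⟩ hp ⟨y, b, u⟩ hp'
      simp only [mem_product, mem_shifts] at hp hp'
      obtain ⟨hx, ⟨a1, a2⟩, a3, a4⟩ := hp
      obtain ⟨hy, ⟨b1, b2⟩, b3, b4⟩ := hp'
      obtain ⟨k1, k2, k3⟩ := inBox_ps_sub hS hx hy
      have hM : (1 : ℤ) ≤ M := by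
        have : (N : ℤ) ≤ M := by exact_mod_cast hNM
        linarith
      have hNM' : (N : ℤ) ≤ M := by exact_mod_cast hNM
      have hM13 : (M : ℤ) ≤ M ^ 3 := by
        have := pow_le_pow_right₀ hM (by norm_num : 1 ≤ 3)
        rwa [pow_one] at this
      have hM23 : (M : ℤ) ^ 2 ≤ M ^ 3 := pow_le_pow_right₀ hM (by norm_num)
      have key : ∀ a t : ℤ, 1 ≤ a → a ≤ N → -(N : ℤ) ≤ t → t ≤ N → |3 * a * t| ≤ 3 * M ^ 3 := by
        intro a t h1 h2 h3 h4
        rw [abs_mul, abs_of_pos (by linarith : 0 < 3 * a)]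
        have h5 : |t| ≤ M := abs_le.2 ⟨by linarith, by linarith⟩
        have h6 : 3 * a ≤ 3 * M := by linarith
        have h7 : 3 * a * |t| ≤ 3 * M * M := by gcongr
        linarith
      have l1 := abs_le.1 (key a t a1 a2 a3 a4)
      have l2 := abs_le.1 (key b u b1 b2 b3 b4)
      simp only [Prod.fst_sub, Prod.snd_sub] at k1 k2 k3
      rw [abs_le] at k1 k2 k3
      push_cast at k1 k2 k3
      refine ⟨?_, ?_, ?_⟩ <;> simp only [hB, shiftVec, Prod.fst_sub, Prod.snd_sub, Prod.fst_add,
        Prod.snd_add] <;> push_cast <;> rw [abs_le]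
      · exact ⟨by linarith [k1.1], by linarith [k1.2]⟩
      · exact ⟨by linarith [k2.1], by linarith [k2.2]⟩
      · exact ⟨by linarith [k3.1], by linarith [k3.2]⟩
  rw [h1, mean_pow_twelve (X := M) (by omega) hS] at h
  refine (coinc_le_mean (B := B) _ _ _ _).trans ?_
  norm_num only at h
  refine le_trans (le_of_eq ?_) h
  congr 1
  funext ψ
  rw [congrFun (expSum_product _ _ _ _) ψ, expSum_tup, norm_mul, norm_pow]
  have := rpow_mul_rpow_eq (θ := 1 / 2) (norm_nonneg (expSum S mom ψ))
    (norm_nonneg (expSum (shifts N) shiftVec ψ)) (by norm_num) (by norm_num) (i := 12) (j := 0)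
    (i' := 8) (j' := 2) (m := 10) (n := 1) (by norm_num) (by norm_num)
  rw [pow_zero, mul_one] at this
  norm_num only at this
  rw [this]
  ring

theorem exists_card_solutions_le {ε : ℝ} (hε : 0 < ε) : ∃ C : ℝ, 0 ≤ C ∧ ∀ N : ℕ, 1 ≤ N →
    (#(solutions N) : ℝ) ≤ C * (N : ℝ) ^ (5 + 2 * ε) := by
  obtain ⟨C₁, hC₁, h₁⟩ := sixthMomentBound hε
  obtain ⟨C₂, hC₂, h₂⟩ := exists_shiftedMoment_le hε
  set A := C₁ * 2 ^ (6 + ε) + C₂ with hA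
  have hA0 : 0 ≤ A := by positivity
  refine ⟨A, hA0, fun N hN => ?_⟩
  have hN1 : (1 : ℝ) ≤ N := by exact_mod_cast hN
  have hN0 : (0 : ℝ) < N := by linarith
  set S := Icc 1 ((2 * N : ℕ) : ℤ) with hS
  set V := (N : ℝ) ^ (6 + 2 * ε) with hV
  have e1 : (sixes S : ℝ) ≤ A * V := by
    refine (h₁ (2 * N) (by omega)).trans ?_
    rw [Nat.cast_mul, Nat.cast_ofNat, Real.mul_rpow (by norm_num) hN0.le, ← mul_assoc]
    refine mul_le_mul (by linarith) (Real.rpow_le_rpow_of_exponent_le hN1 (by linarith))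
      (by positivity) hA0
  have e2 : (shiftedMoment N S : ℝ) ≤ A * V := by
    refine (h₂ N hN).trans (mul_le_mul_of_nonneg_right ?_ (by positivity))
    have : 0 ≤ C₁ * 2 ^ (6 + ε) := by positivity
    linarith
  have e3 : (#(solutions N) : ℝ) * N ≤ A * V := by
    have h := (Nat.cast_le (α := ℝ)).2 (card_solutions_mul_le N)
    rw [Nat.cast_mul] at h
    refine h.trans ((coinc_quintuples_le (M := 2 * N) (by omega) fun n hn => mem_Icc.1 hn).trans ?_)
    refine (mul_le_mul (Real.rpow_le_rpow (by positivity) e1 (by norm_num))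
      (Real.rpow_le_rpow (by positivity) e2 (by norm_num)) (by positivity)
      (by positivity)).trans_eq ?_
    rw [← Real.rpow_add_of_nonneg (by positivity) (by norm_num) (by norm_num)]
    norm_num
  have e4 : V = (N : ℝ) ^ (5 + 2 * ε) * N := by
    rw [hV, ← Real.rpow_add_one hN0.ne']
    congr 1
    ring
  rw [e4, ← mul_assoc] at e3
  exact le_of_mul_le_mul_right e3 hN0

end CubicSystem

theorem stmt3 :
    ∀ ε : ℝ, 0 < ε → ∃ C : ℝ, ∀ N : ℕ, 2 ≤ N →
      (Nat.card {n : Fin 10 → ℕ //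
          (∀ i, 1 ≤ n i ∧ n i ≤ N) ∧
          (∑ i : Fin 5, ((n (Fin.castAdd 5 i) : ℤ) ^ 3 - (n (Fin.addNat i 5) : ℤ) ^ 3)) = 0 ∧
          |∑ i : Fin 5, ((n (Fin.castAdd 5 i) : ℤ) ^ 2 - (n (Fin.addNat i 5) : ℤ) ^ 2)| ≤ (N : ℤ) ∧
          (∑ i : Fin 5, ((n (Fin.castAdd 5 i) : ℤ) - (n (Fin.addNat i 5) : ℤ))) = 0} : ℝ)
        ≤ C * (N:ℝ) ^ ((5:ℝ) + ε) := by
  intro ε hε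
  obtain ⟨C, -, hC⟩ := CubicSystem.exists_card_solutions_le (ε := ε / 2) (by linarith)
  refine ⟨C, fun N hN => ?_⟩
  have h := hC N (by omega)
  rw [mul_div_cancel₀ ε two_ne_zero] at h
  refine le_trans (Nat.cast_le.2 ?_) h
  rw [← Fintype.card_coe, ← Nat.card_eq_fintype_card]
  refine Nat.card_le_card_of_injective
    (fun n => ⟨(fun i => (n.1 (Fin.castAdd 5 i) : ℤ), fun i => (n.1 (Fin.addNat i 5) : ℤ)), ?_⟩) ?_
  · obtain ⟨n, hbox, h3, h2, h1⟩ := n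
    rw [Finset.sum_sub_distrib] at h1 h2 h3
    simp only [CubicSystem.solutions, Finset.mem_filter, Finset.mem_product, CubicSystem.mem_tup,
      Finset.mem_Icc, CubicSystem.ps_eq, Prod.fst_sub, Prod.snd_sub]
    refine ⟨⟨fun i => ?_, fun i => ?_⟩, h1, h2, h3⟩
    · exact_mod_cast hbox _
    · exact_mod_cast hbox _
  · rintro ⟨n, hn⟩ ⟨n', hn'⟩ h
    simp only [Subtype.mk.injEq, Prod.mk.injEq, funext_iff, Nat.cast_inj] at h ⊢
    intro j
    by_cases hj : (j : ℕ) < 5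
    · exact h.1 ⟨j, hj⟩
    · have := h.2 ⟨j - 5, by omega⟩
      rwa [show Fin.addNat (⟨j - 5, by omega⟩ : Fin 5) 5 = j from Fin.ext (by simp; omega)] at this
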